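/- arXiv:1506.03684 — 2 statements merged into one kernel-verified Lean document; each statement's English description precedes it below -/
import Mathlib

section
/- There is a universal constant c > 0 with the following property. Let n ≥ 1 be an integer, M a matroid on {1,…,n}, H ≥ 1, ε ∈ (0,1), and let F = F₁ ⊗ … ⊗ F_n be a product probability measure on ℝⁿ whose marginals F_i are atomless and supported in [1,H]. Then for every integer t ≥ c·(1/ε + ln(H)/ln(1+ε)) and every strict total order ≻ on {1,…,n}, there exists a t-level matroid auction A for M with tie-breaking order ≻ such that E_{v∼F}[Rev_A(v)] ≥ (1−ε)·OPT_M(F). -/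
open MeasureTheory
open scoped ENNReal

attribute [local instance] Classical.propDecidable

/-- A `t`-level single-item auction for `n` bidders: nondecreasing thresholds
`thr i 0 ≤ thr i 1 ≤ … ≤ thr i (t-1)` for each bidder `i`. -/
structure TLevel (n t : ℕ) where
  thr : Fin n → Fin t → ℝ
  mono : ∀ i, Monotone (thr i)

namespace TLevel

/-- The level of a bid `b` for bidder `i`: the largest index `τ` with `thr i τ ≤ b`,
or `-1` if no threshold is met (computed as the number of met thresholds minus one,
which coincides with the largest met index since the thresholds are nondecreasing). -/
noncomputable def level {n t : ℕ} (A : TLevel n t) (i : Fin n) (b : ℝ) : ℤ :=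
  ((Finset.univ.filter fun τ : Fin t => A.thr i τ ≤ b).card : ℤ) - 1

/-- Bidder `i` wins: her level is ≥ 0 and she beats every other bidder, either by a
strictly higher level or by the tie-breaking order `succ` at equal levels. -/
def wins {n t : ℕ} (A : TLevel n t) (succ : Fin n → Fin n → Prop)
    (v : Fin n → ℝ) (i : Fin n) : Prop :=
  0 ≤ A.level i (v i) ∧ ∀ j : Fin n, j ≠ i →
    (A.level j (v j) < A.level i (v i) ∨
      (A.level j (v j) = A.level i (v i) ∧ succ i j))

/-- The winner's payment: the infimum over bids at which she would still win. -/
noncomputable def payment {n t : ℕ} (A : TLevel n t) (succ : Fin n → Fin n → Prop)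
    (v : Fin n → ℝ) (i : Fin n) : ℝ :=
  sInf {b : ℝ | A.wins succ (Function.update v i b) i}

/-- The revenue of the auction on profile `v`: the winner (if any) pays her
critical bid; losers pay nothing. -/
noncomputable def Rev {n t : ℕ} (A : TLevel n t) (succ : Fin n → Fin n → Prop)
    (v : Fin n → ℝ) : ℝ :=
  ∑ i : Fin n, if A.wins succ v i then A.payment succ v i else 0

end TLevel

/-- A matroid on a ground set `E`, given by its independent sets: nonempty (contains ∅),
downward closed, and satisfying the exchange property. -/
structure SimpleMatroid (E : Type*) [DecidableEq E] where
  Indep : Finset E → Prop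
  empty_indep : Indep ∅
  subset_indep : ∀ ⦃I J : Finset E⦄, Indep J → I ⊆ J → Indep I
  exchange : ∀ ⦃I J : Finset E⦄, Indep I → Indep J → I.card < J.card →
    ∃ e ∈ J, e ∉ I ∧ Indep (insert e I)

/-- Greedily scan a list of bidders, adding each eligible bidder whenever the
result stays independent in the matroid `M`. -/
noncomputable def greedyAux {n : ℕ} (M : SimpleMatroid (Fin n)) (ok : Fin n → Prop) :
    List (Fin n) → Finset (Fin n) → Finset (Fin n)
  | [], W => W
  | i :: rest, W =>
      greedyAux M ok rest (if ok i ∧ M.Indep (insert i W) then insert i W else W)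

/-- The winning set of the `t`-level matroid auction `(M, A, succ)` on profile `v`:
consider the bidders with level ≥ 0 in order of decreasing level, breaking ties within
a level by `succ`, and greedily add each bidder whenever independence in `M` is kept. -/
noncomputable def winSet {n t : ℕ} (M : SimpleMatroid (Fin n)) (A : TLevel n t)
    (succ : Fin n → Fin n → Prop) (v : Fin n → ℝ) : Finset (Fin n) :=
  greedyAux M (fun i => 0 ≤ A.level i (v i))
    (List.insertionSort
      (fun i j => A.level j (v j) < A.level i (v i) ∨
        (A.level i (v i) = A.level j (v j) ∧ succ i j))
      (List.finRange n)) ∅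

/-- The payment of bidder `i` in the `t`-level matroid auction: the infimum over bids
at which `i` would still be a winner (losers pay 0 in `RevM` below). -/
noncomputable def paymentM {n t : ℕ} (M : SimpleMatroid (Fin n)) (A : TLevel n t)
    (succ : Fin n → Fin n → Prop) (v : Fin n → ℝ) (i : Fin n) : ℝ :=
  sInf {b : ℝ | i ∈ winSet M A succ (Function.update v i b)}

/-- The revenue of the `t`-level matroid auction on profile `v`: the sum of the
winners' critical payments. -/
noncomputable def RevM {n t : ℕ} (M : SimpleMatroid (Fin n)) (A : TLevel n t)
    (succ : Fin n → Fin n → Prop) (v : Fin n → ℝ) : ℝ :=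
  ∑ i : Fin n, if i ∈ winSet M A succ v then paymentM M A succ v i else 0

/-- A deterministic DSIC-IR matroid auction for matroid `M` with valuations in `V`:
a measurable 0/1 allocation whose set of winners is independent in `M`, and measurable
nonnegative payments bounded by value times allocation, such that truthful bidding is
a dominant strategy. -/
structure MatroidDSICAuction (n : ℕ) (M : SimpleMatroid (Fin n)) (V : Set ℝ) where
  alloc : (Fin n → ℝ) → Fin n → ℝ
  pay : (Fin n → ℝ) → Fin n → ℝ
  alloc_meas : ∀ i, Measurable fun v => alloc v i
  pay_meas : ∀ i, Measurable fun v => pay v i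
  alloc01 : ∀ v i, alloc v i = 0 ∨ alloc v i = 1
  feas : ∀ v, M.Indep (Finset.univ.filter fun i => alloc v i = 1)
  pay_nonneg : ∀ v i, 0 ≤ pay v i
  pay_le : ∀ v, (∀ j, v j ∈ V) → ∀ i, pay v i ≤ v i * alloc v i
  dsic : ∀ v : Fin n → ℝ, (∀ j, v j ∈ V) → ∀ (i : Fin n) (b : ℝ), b ∈ V →
    v i * alloc (Function.update v i b) i - pay (Function.update v i b) i ≤
      v i * alloc v i - pay v i

/-- `OPTM n M V F`: the supremum of expected revenue over all DSIC-IR matroid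
auctions for `M` with valuations in `V`, for bid distribution `F`. -/
noncomputable def OPTM (n : ℕ) (M : SimpleMatroid (Fin n)) (V : Set ℝ)
    (F : Measure (Fin n → ℝ)) : ℝ≥0∞ :=
  ⨆ A : MatroidDSICAuction n M V, ∫⁻ v, ∑ i, ENNReal.ofReal (A.pay v i) ∂F

/-- Inserting into a list sorted by a transitive trichotomous relation keeps it sorted,
provided the inserted element is new. -/
theorem pairwise_orderedInsert_of_trichotomous {α : Type*} {r : α → α → Prop}
    (htrans : ∀ a b c, r a b → r b c → r a c) (htri : ∀ a b, a ≠ b → r a b ∨ r b a) (a : α) :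
    ∀ l : List α, a ∉ l → l.Pairwise r → (l.orderedInsert r a).Pairwise r
  | [], _, _ => by simp
  | b :: l, hal, hl => by
      rw [List.mem_cons, not_or] at hal
      rw [List.pairwise_cons] at hl
      rw [List.orderedInsert_cons]
      split_ifs with hab
      · refine List.pairwise_cons.2 ⟨fun c hc => ?_, List.pairwise_cons.2 hl⟩
        rcases List.mem_cons.1 hc with rfl | hc
        · exact hab
        · exact htrans _ _ _ hab (hl.1 c hc)
      · refine List.pairwise_cons.2 ⟨fun c hc => ?_,
          pairwise_orderedInsert_of_trichotomous htrans htri a l hal.2 hl.2⟩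
        rcases (List.mem_orderedInsert r).1 hc with rfl | hc
        · exact (htri _ _ hal.1).resolve_left hab
        · exact hl.1 c hc

theorem pairwise_insertionSort_of_trichotomous {α : Type*} {r : α → α → Prop}
    (htrans : ∀ a b c, r a b → r b c → r a c) (htri : ∀ a b, a ≠ b → r a b ∨ r b a) :
    ∀ l : List α, l.Nodup → (l.insertionSort r).Pairwise r
  | [], _ => by simp
  | a :: l, h => by
      rw [List.nodup_cons] at h
      exact pairwise_orderedInsert_of_trichotomous htrans htri a _
        (fun hm => h.1 ((List.mem_insertionSort r).1 hm))
        (pairwise_insertionSort_of_trichotomous htrans htri l h.2)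

section Greedy

variable {n : ℕ} {M : SimpleMatroid (Fin n)}

/-- If `I` is a maximal independent subset of `P` and `insert i I` is independent, then
`insert i J` is independent for every independent `J ⊆ P`. -/
theorem SimpleMatroid.indep_insert_of_maximal {I : Finset (Fin n)} {P : Set (Fin n)} {i : Fin n}
    (hI : M.Indep I) (hmax : ∀ e ∈ P, M.Indep (insert e I) → e ∈ I) (hIP : ∀ e ∈ I, e ∈ P)
    (hi : M.Indep (insert i I)) (hiI : i ∉ I) :
    ∀ J : Finset (Fin n), (∀ j ∈ J, j ∈ P) → M.Indep J → M.Indep (insert i J) := by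
  have hcard : ∀ J : Finset (Fin n), (∀ j ∈ J, j ∈ P) → M.Indep J → J.card ≤ I.card := by
    intro J hJP hJ
    by_contra! hlt
    obtain ⟨e, heJ, heI, he⟩ := M.exchange hI hJ hlt
    exact heI (hmax e (hJP e heJ) he)
  suffices h : ∀ k : ℕ, ∀ J : Finset (Fin n), I.card - J.card = k → (∀ j ∈ J, j ∈ P) →
      M.Indep J → M.Indep (insert i J) from fun J => h _ J rfl
  intro k
  induction k using Nat.strong_induction_on with
  | _ k ih =>
    intro J hk hJP hJ
    have h1 := hcard J hJP hJ
    have h2 : (insert i I).card = I.card + 1 := Finset.card_insert_of_notMem hiI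
    obtain ⟨e, heI, heJ, he⟩ := M.exchange hJ hi (by omega)
    rcases Finset.mem_insert.1 heI with rfl | heI
    · exact he
    · have hP : ∀ j ∈ insert e J, j ∈ P := by
        intro j hj
        rcases Finset.mem_insert.1 hj with rfl | hj
        · exact hIP _ heI
        · exact hJP j hj
      have h3 : (insert e J).card = J.card + 1 := Finset.card_insert_of_notMem heJ
      have h4 := hcard _ hP he
      refine M.subset_indep (ih _ ?_ (insert e J) rfl hP he) ?_
      · omega
      · exact Finset.insert_subset_insert _ (Finset.subset_insert _ _)

theorem greedyAux_append (ok : Fin n → Prop) (l₁ l₂ : List (Fin n)) (W : Finset (Fin n)) :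
    greedyAux M ok (l₁ ++ l₂) W = greedyAux M ok l₂ (greedyAux M ok l₁ W) := by
  induction l₁ generalizing W with
  | nil => rfl
  | cons a l ih => exact ih _

theorem subset_greedyAux (ok : Fin n → Prop) (l : List (Fin n)) (W : Finset (Fin n)) :
    W ⊆ greedyAux M ok l W := by
  induction l generalizing W with
  | nil => exact Finset.Subset.refl _
  | cons a l ih =>
    refine Finset.Subset.trans ?_ (ih _)
    split_ifs
    · exact Finset.subset_insert _ _
    · exact Finset.Subset.refl _

theorem mem_or_of_mem_greedyAux {ok : Fin n → Prop} {l : List (Fin n)} {W : Finset (Fin n)}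
    {e : Fin n} (he : e ∈ greedyAux M ok l W) : e ∈ W ∨ (e ∈ l ∧ ok e) := by
  induction l generalizing W with
  | nil => exact Or.inl he
  | cons a l ih =>
    rcases ih he with h | h
    · split_ifs at h with hc
      · rcases Finset.mem_insert.1 h with rfl | h
        · exact Or.inr ⟨List.mem_cons_self, hc.1⟩
        · exact Or.inl h
      · exact Or.inl h
    · exact Or.inr ⟨List.mem_cons_of_mem _ h.1, h.2⟩

theorem indep_greedyAux (ok : Fin n → Prop) (l : List (Fin n)) {W : Finset (Fin n)}
    (hW : M.Indep W) : M.Indep (greedyAux M ok l W) := by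
  induction l generalizing W with
  | nil => exact hW
  | cons a l ih =>
    refine ih ?_
    split_ifs with h
    · exact h.2
    · exact hW

theorem mem_greedyAux_of_indep_insert {ok : Fin n → Prop} {l : List (Fin n)}
    {W : Finset (Fin n)} {e : Fin n} (hel : e ∈ l) (hok : ok e)
    (h : M.Indep (insert e (greedyAux M ok l W))) : e ∈ greedyAux M ok l W := by
  induction l generalizing W with
  | nil => simp at hel
  | cons a l ih =>
    rcases List.mem_cons.1 hel with rfl | hel
    · have hsub := subset_greedyAux (M := M) ok (e :: l) W
      have hind : M.Indep (insert e W) := M.subset_indep h (Finset.insert_subset_insert _ hsub)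
      have : greedyAux M ok (e :: l) W = greedyAux M ok l (insert e W) := by
        rw [greedyAux, if_pos ⟨hok, hind⟩]
      rw [this]
      exact subset_greedyAux ok l _ (Finset.mem_insert_self _ _)
    · exact ih hel h

/-- The greedy algorithm selects `i` iff `i` is eligible and extends every independent set of
eligible elements preceding it. -/
theorem mem_greedyAux_iff {r : Fin n → Fin n → Prop} (hasymm : ∀ a b, r a b → ¬ r b a)
    {l : List (Fin n)} (hl : l.Pairwise r) (hmem : ∀ i, i ∈ l) (ok : Fin n → Prop) (i : Fin n) :
    i ∈ greedyAux M ok l ∅ ↔ ok i ∧ ∀ J : Finset (Fin n), (∀ j ∈ J, ok j ∧ r j i) →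
      M.Indep J → M.Indep (insert i J) := by
  obtain ⟨l₁, l₂, rfl⟩ := List.append_of_mem (hmem i)
  rw [List.pairwise_append, List.pairwise_cons] at hl
  obtain ⟨-, ⟨h2, -⟩, h1⟩ := hl
  have hirr : ∀ a, ¬ r a a := fun a h => hasymm a a h h
  have hl₁ : ∀ j, j ∈ l₁ ↔ r j i := by
    intro j
    refine ⟨fun hj => h1 j hj i List.mem_cons_self, fun hj => ?_⟩
    rcases List.mem_append.1 (hmem j) with h | h
    · exact h
    · rcases List.mem_cons.1 h with rfl | h
      · exact absurd hj (hirr _)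
      · exact absurd hj (hasymm _ _ (h2 j h))
  have hi₁ : i ∉ l₁ := fun h => hirr i ((hl₁ i).1 h)
  have hi₂ : i ∉ l₂ := fun h => hirr i (h2 i h)
  set I := greedyAux M ok l₁ ∅ with hIdef
  have hI : M.Indep I := indep_greedyAux ok l₁ M.empty_indep
  have hImem : ∀ e ∈ I, e ∈ l₁ ∧ ok e := fun e he =>
    (mem_or_of_mem_greedyAux he).resolve_left (Finset.notMem_empty e)
  have hiI : i ∉ I := fun h => hi₁ (hImem i h).1
  have key : i ∈ greedyAux M ok (l₁ ++ i :: l₂) ∅ ↔ ok i ∧ M.Indep (insert i I) := by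
    rw [greedyAux_append, ← hIdef, greedyAux]
    by_cases hc : ok i ∧ M.Indep (insert i I)
    · rw [if_pos hc]
      exact iff_of_true (subset_greedyAux ok l₂ _ (Finset.mem_insert_self _ _)) hc
    · rw [if_neg hc]
      refine iff_of_false (fun h => ?_) hc
      rcases mem_or_of_mem_greedyAux h with h | h
      · exact hiI h
      · exact hi₂ h.1
  rw [key]
  refine and_congr_right fun _ => ⟨fun h => ?_, fun h => h I (fun j hj => ?_) hI⟩
  · refine SimpleMatroid.indep_insert_of_maximal (P := {j | ok j ∧ r j i}) hI ?_ ?_ h hiI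
    · exact fun e he hind => mem_greedyAux_of_indep_insert ((hl₁ e).2 he.2) he.1 hind
    · exact fun e he => ⟨(hImem e he).2, (hl₁ e).1 (hImem e he).1⟩
  · exact ⟨(hImem j hj).2, (hl₁ j).1 (hImem j hj).1⟩

/-- The order in which bidders with levels `ℓ` are considered. -/
def levelOrder (succ : Fin n → Fin n → Prop) (ℓ : Fin n → ℤ) (i j : Fin n) : Prop :=
  ℓ j < ℓ i ∨ (ℓ i = ℓ j ∧ succ i j)

variable (M) in
/-- The winning set as a function of the levels only. -/
noncomputable def levelWinners (succ : Fin n → Fin n → Prop) (ℓ : Fin n → ℤ) : Finset (Fin n) :=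
  greedyAux M (fun i => 0 ≤ ℓ i)
    (List.insertionSort (fun i j => ℓ j < ℓ i ∨ (ℓ i = ℓ j ∧ succ i j)) (List.finRange n)) ∅

theorem winSet_eq_levelWinners {t : ℕ} (A : TLevel n t) (succ : Fin n → Fin n → Prop)
    (v : Fin n → ℝ) : winSet M A succ v = levelWinners M succ fun i => A.level i (v i) := rfl

theorem levelOrder_asymm {succ : Fin n → Fin n → Prop}
    (hs : IsStrictTotalOrder (Fin n) succ) (ℓ : Fin n → ℤ) (a b : Fin n) (h : levelOrder succ ℓ a b) :
    ¬ levelOrder succ ℓ b a := by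
  rintro (h' | ⟨h1', h2'⟩) <;> rcases h with h | ⟨h1, h2⟩
  · omega
  · omega
  · omega
  · exact asymm_of succ h2 h2'

theorem pairwise_levelOrder {succ : Fin n → Fin n → Prop}
    (hs : IsStrictTotalOrder (Fin n) succ) (ℓ : Fin n → ℤ) :
    (List.insertionSort (levelOrder succ ℓ) (List.finRange n)).Pairwise (levelOrder succ ℓ) := by
  refine pairwise_insertionSort_of_trichotomous ?_ ?_ _ (List.nodup_finRange n)
  · rintro a b c (h1 | ⟨h1, h1'⟩) (h2 | ⟨h2, h2'⟩)
    · exact Or.inl (by omega)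
    · exact Or.inl (by omega)
    · exact Or.inl (by omega)
    · exact Or.inr ⟨by omega, trans_of succ h1' h2'⟩
  · intro a b hab
    unfold levelOrder
    rcases lt_trichotomy (ℓ a) (ℓ b) with h | h | h
    · exact Or.inr (Or.inl h)
    · rcases trichotomous_of succ a b with h' | h' | h'
      · exact Or.inl (Or.inr ⟨h, h'⟩)
      · exact absurd h' hab
      · exact Or.inr (Or.inr ⟨h.symm, h'⟩)
    · exact Or.inl (Or.inl h)

theorem mem_greedyAux_levelOrder_iff {succ : Fin n → Fin n → Prop}
    (hs : IsStrictTotalOrder (Fin n) succ) (ℓ : Fin n → ℤ) (ok : Fin n → Prop) (i : Fin n) :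
    i ∈ greedyAux M ok (List.insertionSort (levelOrder succ ℓ) (List.finRange n)) ∅ ↔
      ok i ∧ ∀ J : Finset (Fin n), (∀ j ∈ J, ok j ∧ levelOrder succ ℓ j i) →
        M.Indep J → M.Indep (insert i J) :=
  mem_greedyAux_iff (levelOrder_asymm hs ℓ) (pairwise_levelOrder hs ℓ) (fun i => by simp) ok i

theorem mem_levelWinners_iff {succ : Fin n → Fin n → Prop}
    (hs : IsStrictTotalOrder (Fin n) succ) (ℓ : Fin n → ℤ) (i : Fin n) :
    i ∈ levelWinners M succ ℓ ↔
      0 ≤ ℓ i ∧ ∀ J : Finset (Fin n), (∀ j ∈ J, 0 ≤ ℓ j ∧ levelOrder succ ℓ j i) →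
        M.Indep J → M.Indep (insert i J) := by
  have h := mem_greedyAux_levelOrder_iff (M := M) hs ℓ (fun i => 0 ≤ ℓ i) i
  unfold levelWinners
  convert h using 3
  unfold levelOrder
  congr!

/-- Raising the level of a winner keeps her winning. -/
theorem mem_levelWinners_update_of_le {succ : Fin n → Fin n → Prop}
    (hs : IsStrictTotalOrder (Fin n) succ) (ℓ : Fin n → ℤ) (i : Fin n) {a b : ℤ} (hab : a ≤ b)
    (h : i ∈ levelWinners M succ (Function.update ℓ i a)) :
    i ∈ levelWinners M succ (Function.update ℓ i b) := by
  rw [mem_levelWinners_iff hs] at h ⊢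
  simp only [Function.update_self] at h ⊢
  refine ⟨h.1.trans hab, fun J hJ hind => h.2 J (fun j hj => ?_) hind⟩
  obtain ⟨h1, h2⟩ := hJ j hj
  have hji : j ≠ i := by
    rintro rfl
    exact levelOrder_asymm hs _ _ _ h2 h2
  simp only [levelOrder, Function.update_self, Function.update_of_ne hji] at h1 h2 ⊢
  refine ⟨h1, ?_⟩
  rcases h2 with h2 | ⟨h2, h2'⟩
  · exact Or.inl (by omega)
  · rcases hab.lt_or_eq with h3 | h3
    · exact Or.inl (by omega)
    · exact Or.inr ⟨by omega, h2'⟩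

/-- Among the bidders of level at least `k ≥ 0`, the winning set has maximum cardinality. -/
theorem card_filter_level_le {succ : Fin n → Fin n → Prop}
    (hs : IsStrictTotalOrder (Fin n) succ) (ℓ : Fin n → ℤ) {k : ℤ} (hk : 0 ≤ k) {I : Finset (Fin n)}
    (hI : M.Indep I) :
    (I.filter fun i => k ≤ ℓ i).card ≤ ((levelWinners M succ ℓ).filter fun i => k ≤ ℓ i).card := by
  set L := List.insertionSort (levelOrder succ ℓ) (List.finRange n)
  have hW : ((levelWinners M succ ℓ).filter fun i => k ≤ ℓ i)
      = greedyAux M (fun i => k ≤ ℓ i) L ∅ := by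
    ext i
    rw [Finset.mem_filter, mem_levelWinners_iff hs, mem_greedyAux_levelOrder_iff hs]
    constructor
    · rintro ⟨⟨-, h2⟩, h3⟩
      exact ⟨h3, fun J hJ => h2 J fun j hj => ⟨hk.trans (hJ j hj).1, (hJ j hj).2⟩⟩
    · rintro ⟨h3, h2⟩
      refine ⟨⟨hk.trans h3, fun J hJ => h2 J fun j hj => ⟨?_, (hJ j hj).2⟩⟩, h3⟩
      rcases (hJ j hj).2 with h | ⟨h, -⟩ <;> omega
  rw [hW]
  by_contra! hlt
  obtain ⟨e, heI, heW, he⟩ := M.exchange (indep_greedyAux _ L M.empty_indep)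
    (M.subset_indep hI (Finset.filter_subset _ _)) hlt
  exact heW (mem_greedyAux_of_indep_insert (by simp [L]) (Finset.mem_filter.1 heI).2 he)

theorem TLevel.le_level_iff {t : ℕ} (A : TLevel n t) (i : Fin n) (b : ℝ) (k : Fin t) :
    ((k : ℕ) : ℤ) ≤ A.level i b ↔ A.thr i k ≤ b := by
  unfold TLevel.level
  constructor
  · intro h
    by_contra hb
    have hsub : (Finset.univ.filter fun τ : Fin t => A.thr i τ ≤ b) ⊆ Finset.Iio k := by
      intro τ hτ
      rw [Finset.mem_Iio]
      by_contra! hle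
      exact hb ((A.mono i hle).trans (Finset.mem_filter.1 hτ).2)
    have := Finset.card_le_card hsub
    rw [Fin.card_Iio] at this
    omega
  · intro h
    have hsub : Finset.Iic k ⊆ (Finset.univ.filter fun τ : Fin t => A.thr i τ ≤ b) := by
      intro τ hτ
      exact Finset.mem_filter.2 ⟨Finset.mem_univ _, (A.mono i (Finset.mem_Iic.1 hτ)).trans h⟩
    have := Finset.card_le_card hsub
    rw [Fin.card_Iic] at this
    omega

theorem TLevel.level_lt {t : ℕ} (A : TLevel n t) (i : Fin n) (b : ℝ) : A.level i b < t := by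
  unfold TLevel.level
  have := Finset.card_filter_le (Finset.univ : Finset (Fin t)) (fun τ : Fin t => A.thr i τ ≤ b)
  rw [Finset.card_univ, Fintype.card_fin] at this
  omega

/-- With the other bids fixed, the winning bids of a bidder are either none, or exactly those
meeting one of her thresholds. -/
theorem exists_winning_threshold {t : ℕ} (A : TLevel n t) {succ : Fin n → Fin n → Prop}
    (hs : IsStrictTotalOrder (Fin n) succ) (v : Fin n → ℝ) (i : Fin n) :
    (∀ b, i ∉ winSet M A succ (Function.update v i b)) ∨
      ∃ k : Fin t, ∀ b, i ∈ winSet M A succ (Function.update v i b) ↔ A.thr i k ≤ b := by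
  set ℓ : Fin n → ℤ := fun j => A.level j (v j)
  have hℓ : ∀ b, (fun j => A.level j (Function.update v i b j))
      = Function.update ℓ i (A.level i b) := by
    intro b
    ext j
    by_cases h : j = i
    · subst h; simp
    · simp [h, ℓ]
  simp only [winSet_eq_levelWinners, hℓ]
  by_cases hex : ∃ k : ℕ, k < t ∧ i ∈ levelWinners M succ (Function.update ℓ i (k : ℤ))
  · right
    obtain ⟨hk, hwin⟩ := Nat.find_spec hex
    refine ⟨⟨Nat.find hex, hk⟩, fun b => ?_⟩
    rw [← A.le_level_iff]
    refine ⟨fun h => ?_, fun h => mem_levelWinners_update_of_le hs ℓ i h hwin⟩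
    have h0 : 0 ≤ A.level i b := by
      have := ((mem_levelWinners_iff hs _ i).1 h).1
      simpa using this
    have hb : ((A.level i b).toNat : ℤ) = A.level i b := Int.toNat_of_nonneg h0
    have := Nat.find_min' hex (m := (A.level i b).toNat)
      ⟨by have := A.level_lt i b; omega, by rw [hb]; exact h⟩
    push_cast
    omega
  · left
    intro b h
    have h0 : 0 ≤ A.level i b := by
      have := ((mem_levelWinners_iff hs _ i).1 h).1
      simpa using this
    have hb : ((A.level i b).toNat : ℤ) = A.level i b := Int.toNat_of_nonneg h0
    exact hex ⟨(A.level i b).toNat, by have := A.level_lt i b; omega, by rw [hb]; exact h⟩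

end Greedy

section Pricing

/-- The tail of an atomless probability measure on `ℝ` is continuous. -/
theorem continuous_measureReal_Ici (μ : Measure ℝ) [IsProbabilityMeasure μ]
    (hatom : ∀ x, μ {x} = 0) : Continuous fun q => μ.real (Set.Ici q) := by
  have heq : (fun q => μ.real (Set.Ici q))
      = fun q => ∫ x, (Set.Ici q).indicator (fun _ => (1 : ℝ)) x ∂μ := by
    ext q
    rw [integral_indicator_const _ measurableSet_Ici, smul_eq_mul, mul_one]
  rw [heq, continuous_iff_continuousAt]
  intro q₀
  refine continuousAt_of_dominated (bound := fun _ => 1)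
    (Filter.Eventually.of_forall fun q =>
      (measurable_const.indicator measurableSet_Ici).aestronglyMeasurable)
    (Filter.Eventually.of_forall fun q => Filter.Eventually.of_forall fun x => ?_)
    (integrable_const _) ?_
  · by_cases hx : x ∈ Set.Ici q <;> simp [hx]
  · have hne : ∀ᵐ x ∂μ, x ≠ q₀ := by
      rw [ae_iff]
      simpa using hatom q₀
    filter_upwards [hne] with x hx
    rcases lt_or_gt_of_ne hx with h | h
    · refine (continuousAt_const (y := (0 : ℝ))).congr ?_
      filter_upwards [Ioi_mem_nhds h] with q hq
      exact (Set.indicator_of_notMem (by simpa using hq) _).symm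
    · refine (continuousAt_const (y := (1 : ℝ))).congr ?_
      filter_upwards [Iio_mem_nhds h] with q hq
      have hqx : q < x := hq
      simp [hqx.le]

theorem measureReal_Ici_eq_zero (μ : Measure ℝ) [IsProbabilityMeasure μ]
    (hatom : ∀ x, μ {x} = 0) {H : ℝ} (hsupp : μ (Set.Icc 1 H) = 1) {q : ℝ} (hq : H ≤ q) :
    μ.real (Set.Ici q) = 0 := by
  have hsub : Set.Ici q ⊆ {H} ∪ (Set.Icc 1 H)ᶜ := by
    intro x hx
    rcases (hq.trans hx).eq_or_lt with h | h
    · exact Or.inl h.symm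
    · exact Or.inr fun h' => absurd h'.2 (not_le.2 h)
  have hcompl : μ (Set.Icc 1 H)ᶜ = 0 := (prob_compl_eq_zero_iff measurableSet_Icc).2 hsupp
  have : μ (Set.Ici q) = 0 := measure_mono_null hsub (measure_union_null (hatom H) hcompl)
  simp [Measure.real, this]

/-- For an atomless distribution on `[1, H]`, the optimal posted price against a cost `x` can be
chosen monotone in `x`. -/
theorem exists_monotone_optimal_price (μ : Measure ℝ) [IsProbabilityMeasure μ]
    (hatom : ∀ x, μ {x} = 0) {H : ℝ} (hH : 1 ≤ H) (hsupp : μ (Set.Icc 1 H) = 1) :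
    ∃ p : ℝ → ℝ, Monotone p ∧ (∀ x, p x ∈ Set.Icc 1 H) ∧
      ∀ x q, (q - x) * μ.real (Set.Ici q) ≤ (p x - x) * μ.real (Set.Ici (p x)) := by
  set S : ℝ → ℝ := fun q => μ.real (Set.Ici q) with hS
  have hcont : Continuous S := continuous_measureReal_Ici μ hatom
  have hanti : Antitone S := fun q q' h => measureReal_mono (Set.Ici_subset_Ici.2 h)
  have hnn : ∀ q, 0 ≤ S q := fun q => measureReal_nonneg
  have hone : ∀ q ≤ 1, S q = 1 := by
    intro q hq
    refine le_antisymm measureReal_le_one ?_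
    have : μ.real (Set.Icc 1 H) = 1 := by simp [Measure.real, hsupp]
    rw [← this]
    exact measureReal_mono fun x hx => hq.trans hx.1
  have hzero : ∀ q, H ≤ q → S q = 0 := fun q =>
    measureReal_Ici_eq_zero μ hatom hsupp
  have hex : ∀ x, ∃ p ∈ Set.Icc 1 H, (∀ q, (q - x) * S q ≤ (p - x) * S p) ∧
      (S p = 0 → p = H) := by
    intro x
    obtain ⟨p, hp, hmax⟩ := isCompact_Icc.exists_isMaxOn (Set.nonempty_Icc.2 hH)
      (f := fun q => (q - x) * S q) (by fun_prop)
    have hopt : ∀ q, (q - x) * S q ≤ (p - x) * S p := by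
      intro q
      rcases lt_or_ge q 1 with h | h
      · have h1 : (1 - x) * S 1 ≤ (p - x) * S p := hmax ⟨le_rfl, hH⟩
        rw [hone 1 le_rfl] at h1
        rw [hone q h.le]
        linarith
      · rcases le_or_gt q H with h' | h'
        · exact hmax ⟨h, h'⟩
        · have h1 : (H - x) * S H ≤ (p - x) * S p := hmax ⟨hH, le_rfl⟩
          rw [hzero H le_rfl] at h1
          rw [hzero q h'.le]
          linarith
    by_cases h0 : S p = 0
    · refine ⟨H, ⟨hH, le_rfl⟩, fun q => ?_, fun _ => rfl⟩
      have := hopt q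
      rw [h0] at this
      rw [hzero H le_rfl]
      linarith
    · exact ⟨p, hp, hopt, fun h => absurd h h0⟩
  choose p hp hopt hcan using hex
  refine ⟨p, fun x y hxy => ?_, hp, hopt⟩
  by_contra! hlt
  have hxy : x < y := lt_of_le_of_ne hxy (by rintro rfl; exact lt_irrefl _ hlt)
  have h1 := hopt x (p y)
  have h2 := hopt y (p x)
  have h3 : S (p x) ≤ S (p y) := hanti hlt.le
  have h4 : S (p x) = S (p y) := by nlinarith
  rw [← h4] at h2
  have h5 : S (p x) = 0 := by nlinarith [hnn (p x)]
  have h6 := hcan x h5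
  have h7 := hcan y (h4 ▸ h5)
  linarith

/-- The revenue of a posted price is at most the expected upper virtual weight of the sold bids. -/
theorem mul_le_sum_upper {S p : ℝ → ℝ} (hnn : ∀ q, 0 ≤ S q) (hp : Monotone p)
    (hopt : ∀ x q, (q - x) * S q ≤ (p x - x) * S (p x))
    {L : ℕ → ℝ} (hL : Monotone L) {H : ℝ} (hzero : ∀ q, H ≤ q → S q = 0) (h0 : L 0 = 0) {t : ℕ}
    (ht : H ≤ L t) (c : ℝ) :
    c * S c ≤ ∑ k ∈ Finset.range t, (L (k + 1) - L k) * S (max c (p (L k))) := by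
  suffices h : ∀ m ≤ t, ∀ c, (c - L m) * S c
      ≤ ∑ k ∈ Finset.Ico m t, (L (k + 1) - L k) * S (max c (p (L k))) by
    have := h 0 (Nat.zero_le _) c
    rwa [h0, sub_zero, ← Finset.range_eq_Ico] at this
  intro m hm
  induction hm using Nat.decreasingInduction with
  | self =>
    intro c
    rw [Finset.Ico_self, Finset.sum_empty]
    rcases le_or_gt H c with h | h
    · rw [hzero c h, mul_zero]
    · exact mul_nonpos_of_nonpos_of_nonneg (by linarith) (hnn c)
  | of_succ m hm ih =>
    intro c
    set q := max c (p (L m)) with hq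
    have h1 : (c - L m) * S c ≤ (q - L m) * S q := by
      rcases max_cases c (p (L m)) with ⟨h, -⟩ | ⟨h, -⟩
      · rw [hq, h]
      · rw [hq, h]
        exact hopt _ _
    have h2 := ih q
    rw [Finset.sum_eq_sum_Ico_succ_bot hm]
    have h3 : ∑ k ∈ Finset.Ico (m + 1) t, (L (k + 1) - L k) * S (max c (p (L k)))
        = ∑ k ∈ Finset.Ico (m + 1) t, (L (k + 1) - L k) * S (max q (p (L k))) := by
      refine Finset.sum_congr rfl fun k hk => ?_
      have hmk : p (L m) ≤ p (L k) := hp (hL (by have := (Finset.mem_Ico.1 hk).1; omega))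
      rw [hq, max_assoc, max_eq_right hmk]
    rw [h3]
    nlinarith

/-- The expected lower virtual weight of the bids above one of the thresholds is at most the
revenue of posting that threshold. -/
theorem sum_lower_le_mul {S p : ℝ → ℝ} (hp : Monotone p)
    (hopt : ∀ x q, (q - x) * S q ≤ (p x - x) * S (p x))
    {L : ℕ → ℝ} (hL : Monotone L) {H : ℝ} (hzero : ∀ q, H ≤ q → S q = 0) (h0 : L 0 = 0)
    {s k : ℕ} (hk : k ≤ s) :
    ∑ j ∈ Finset.range s, (L (j + 1) - L j) * S (max (p (L k)) (p (L (j + 1))))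
      ≤ p (L k) * S (p (L k)) := by
  have key : ∀ m ≤ s, ∑ j ∈ Finset.Ico m s, (L (j + 1) - L j) * S (p (L (j + 1)))
      ≤ (p (L m) - L m) * S (p (L m)) := by
    intro m hm
    induction hm using Nat.decreasingInduction with
    | self =>
      rw [Finset.Ico_self, Finset.sum_empty]
      have := hopt (L s) H
      rwa [hzero H le_rfl, mul_zero] at this
    | of_succ m hm ih =>
      rw [Finset.sum_eq_sum_Ico_succ_bot hm]
      have := hopt (L m) (p (L (m + 1)))
      linarith
  rw [← Finset.sum_range_add_sum_Ico _ hk]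
  have h1 : ∑ j ∈ Finset.range k, (L (j + 1) - L j) * S (max (p (L k)) (p (L (j + 1))))
      = L k * S (p (L k)) := by
    rw [Finset.sum_congr rfl (g := fun j => (L (j + 1) - L j) * S (p (L k)))]
    · rw [← Finset.sum_mul, Finset.sum_range_sub, h0, sub_zero]
    · intro j hj
      rw [max_eq_left (hp (hL (Finset.mem_range.1 hj)))]
  have h2 : ∑ j ∈ Finset.Ico k s, (L (j + 1) - L j) * S (max (p (L k)) (p (L (j + 1))))
      = ∑ j ∈ Finset.Ico k s, (L (j + 1) - L j) * S (p (L (j + 1))) := by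
    refine Finset.sum_congr rfl fun j hj => ?_
    rw [max_eq_right (hp (hL ((Finset.mem_Ico.1 hj).1.trans (Nat.le_succ j))))]
  rw [h1, h2]
  linarith [key k hk]

/-- The step function with increments `d k` at the thresholds `Q k`, `k < m`. -/
noncomputable def stepWeight (d Q : ℕ → ℝ) (m : ℕ) (b : ℝ) : ℝ≥0∞ :=
  ∑ k ∈ Finset.range m, ENNReal.ofReal (d k) * (Set.Ici (Q k)).indicator 1 b

theorem measurable_stepWeight (d Q : ℕ → ℝ) (m : ℕ) : Measurable (stepWeight d Q m) := by
  unfold stepWeight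
  exact Finset.measurable_sum _ fun k _ =>
    (measurable_one.indicator measurableSet_Ici).const_mul _

theorem lintegral_indicator_stepWeight (μ : Measure ℝ) [IsProbabilityMeasure μ] {d : ℕ → ℝ}
    (hd : ∀ k, 0 ≤ d k) (Q : ℕ → ℝ) (m : ℕ) (c : ℝ) :
    ∫⁻ b, (Set.Ici c).indicator (stepWeight d Q m) b ∂μ
      = ENNReal.ofReal (∑ k ∈ Finset.range m, d k * μ.real (Set.Ici (max c (Q k)))) := by
  rw [lintegral_indicator measurableSet_Ici]
  unfold stepWeight
  rw [lintegral_finsetSum _ fun k _ =>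
      (measurable_one.indicator measurableSet_Ici).const_mul _,
    ENNReal.ofReal_sum_of_nonneg fun k _ => mul_nonneg (hd k) measureReal_nonneg]
  refine Finset.sum_congr rfl fun k _ => ?_
  rw [lintegral_const_mul _ (measurable_one.indicator measurableSet_Ici),
    lintegral_indicator_one measurableSet_Ici, Measure.restrict_apply measurableSet_Ici,
    Set.Ici_inter_Ici, sup_comm, ENNReal.ofReal_mul (hd k), ofReal_measureReal]

end Pricing

section Revenue

variable {n : ℕ} {M : SimpleMatroid (Fin n)} {H : ℝ} {Fi : Fin n → Measure ℝ}

/-- Valuations lie in the box `[1, H]ⁿ` almost surely. -/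
theorem ae_forall_mem_Icc [∀ i, IsProbabilityMeasure (Fi i)]
    (hsupp : ∀ i, Fi i (Set.Icc 1 H) = 1) :
    ∀ᵐ v ∂Measure.pi Fi, ∀ j, v j ∈ Set.Icc 1 H := by
  rw [ae_all_iff]
  intro j
  have h : ∀ᵐ x ∂Fi j, x ∈ Set.Icc 1 H := by
    rw [ae_iff]
    exact (prob_compl_eq_zero_iff measurableSet_Icc).2 (hsupp j)
  exact (measurePreserving_eval Fi j).quasiMeasurePreserving.ae h

/-- If every posted price to bidder `i` earns at most the `w`-weight of the bids it sells to, then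
the expected payment of `i` in any DSIC-IR auction is at most the expected `w`-weight of `i`'s
winning bids. -/
theorem lintegral_pay_le [∀ i, IsProbabilityMeasure (Fi i)]
    (hatom : ∀ i, ∀ x : ℝ, Fi i {x} = 0) (hsupp : ∀ i, Fi i (Set.Icc 1 H) = 1)
    (B : MatroidDSICAuction n M (Set.Icc 1 H)) (i : Fin n) {w : ℝ → ℝ≥0∞} (hw : Measurable w)
    (h : ∀ c, ENNReal.ofReal c * Fi i (Set.Ici c) ≤ ∫⁻ b, (Set.Ici c).indicator w b ∂Fi i) :
    ∫⁻ v, ENNReal.ofReal (B.pay v i) ∂Measure.pi Fi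
      ≤ ∫⁻ v, (if B.alloc v i = 1 then w (v i) else 0) ∂Measure.pi Fi := by
  set box : Set (Fin n → ℝ) := {v | ∀ j, v j ∈ Set.Icc 1 H} with hbox
  have hboxm : MeasurableSet box := by
    rw [hbox, Set.ofPred_forall]
    exact MeasurableSet.iInter fun j => measurable_pi_apply j measurableSet_Icc
  have hae := ae_forall_mem_Icc hsupp
  set f : (Fin n → ℝ) → ℝ≥0∞ := fun v => ENNReal.ofReal (B.pay v i)
  set g : (Fin n → ℝ) → ℝ≥0∞ := fun v => if B.alloc v i = 1 then w (v i) else 0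
  have hf : Measurable f := (B.pay_meas i).ennreal_ofReal
  have hg : Measurable g :=
    Measurable.ite (B.alloc_meas i (measurableSet_singleton 1))
      (hw.comp (measurable_pi_apply i)) measurable_const
  have hf' : ∫⁻ v, f v ∂Measure.pi Fi = ∫⁻ v, box.indicator f v ∂Measure.pi Fi :=
    lintegral_congr_ae (by
      filter_upwards [hae] with v hv
      exact (Set.indicator_of_mem (show v ∈ box from hv) f).symm)
  have hg' : ∫⁻ v, box.indicator g v ∂Measure.pi Fi ≤ ∫⁻ v, g v ∂Measure.pi Fi :=
    lintegral_mono (Set.indicator_le_self _ _)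
  rw [hf']
  refine le_trans ?_ hg'
  refine lintegral_le_of_lmarginal_le {i} (hf.indicator hboxm) (hg.indicator hboxm) ?_
  rw [lmarginal_singleton, lmarginal_singleton]
  intro v
  dsimp only
  by_cases hv : ∀ j, j ≠ i → v j ∈ Set.Icc 1 H
  swap
  · have hout : ∀ b, Function.update v i b ∉ box := by
      intro b hb
      refine hv fun j hj => ?_
      have := hb j
      rwa [Function.update_of_ne hj] at this
    simp [Set.indicator_of_notMem (hout _)]
  have hin : ∀ b ∈ Set.Icc 1 H, Function.update v i b ∈ box := by
    intro b hb j
    by_cases hj : j = i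
    · subst hj; simpa using hb
    · rw [Function.update_of_ne hj]; exact hv j hj
  have hIcc : ∀ᵐ b ∂Fi i, b ∈ Set.Icc 1 H := by
    rw [ae_iff]
    exact (prob_compl_eq_zero_iff measurableSet_Icc).2 (hsupp i)
  have hdsic : ∀ b ∈ Set.Icc 1 H, ∀ b' ∈ Set.Icc 1 H,
      b * B.alloc (Function.update v i b') i - B.pay (Function.update v i b') i
        ≤ b * B.alloc (Function.update v i b) i - B.pay (Function.update v i b) i := by
    intro b hb b' hb'
    simpa using B.dsic (Function.update v i b) (hin b hb) i b' hb'
  have hlose : ∀ b ∈ Set.Icc 1 H, B.alloc (Function.update v i b) i = 0 →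
      B.pay (Function.update v i b) i = 0 := by
    intro b hb h0
    refine le_antisymm ?_ (B.pay_nonneg _ _)
    have := B.pay_le _ (hin b hb) i
    rwa [h0, mul_zero] at this
  by_cases hex : ∃ b ∈ Set.Icc 1 H, B.alloc (Function.update v i b) i = 1
  swap
  · push Not at hex
    have hzero : ∫⁻ b, box.indicator f (Function.update v i b) ∂Fi i = 0 := by
      rw [lintegral_congr_ae (g := fun _ => 0), lintegral_zero]
      filter_upwards [hIcc] with b hb
      have := hlose b hb ((B.alloc01 _ i).resolve_right (hex b hb))
      rw [Set.indicator_of_mem (hin b hb)]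
      simp only [f, this, ENNReal.ofReal_zero]
    rw [hzero]
    exact zero_le
  obtain ⟨b₀, hb₀, hwin₀⟩ := hex
  set c := B.pay (Function.update v i b₀) i with hc
  have hwin : ∀ b ∈ Set.Icc 1 H, B.alloc (Function.update v i b) i = 1 →
      B.pay (Function.update v i b) i = c ∧ c ≤ b := by
    intro b hb h1
    have h2 := hdsic b hb b₀ hb₀
    have h3 := hdsic b₀ hb₀ b hb
    have h4 := B.pay_le _ (hin b hb) i
    rw [Function.update_self, h1] at h4
    rw [h1, hwin₀] at h2 h3
    have h5 : B.pay (Function.update v i b) i = c := by linarith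
    exact ⟨h5, by linarith⟩
  have hlose' : ∀ b ∈ Set.Icc 1 H, B.alloc (Function.update v i b) i = 0 → b ≤ c := by
    intro b hb h0
    have h2 := hdsic b hb b₀ hb₀
    rw [hwin₀, h0, hlose b hb h0] at h2
    linarith
  calc ∫⁻ b, box.indicator f (Function.update v i b) ∂Fi i
      ≤ ∫⁻ b, (Set.Ici c).indicator (fun _ => ENNReal.ofReal c) b ∂Fi i := by
        refine lintegral_mono_ae ?_
        filter_upwards [hIcc] with b hb
        rw [Set.indicator_of_mem (hin b hb)]
        rcases B.alloc01 (Function.update v i b) i with h0 | h1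
        · simp only [f, hlose b hb h0, ENNReal.ofReal_zero]
          exact zero_le
        · obtain ⟨h2, h3⟩ := hwin b hb h1
          rw [Set.indicator_of_mem (Set.mem_Ici.2 h3)]
          simp only [f, h2, le_refl]
    _ = ENNReal.ofReal c * Fi i (Set.Ici c) := lintegral_indicator_const measurableSet_Ici _
    _ ≤ ∫⁻ b, (Set.Ici c).indicator w b ∂Fi i := h c
    _ ≤ ∫⁻ b, box.indicator g (Function.update v i b) ∂Fi i := by
        have hne : ∀ᵐ b ∂Fi i, b ≠ c := by
          rw [ae_iff]
          simpa using hatom i c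
        refine lintegral_mono_ae ?_
        filter_upwards [hIcc, hne] with b hb hbc
        rw [Set.indicator_of_mem (hin b hb)]
        by_cases hcb : c ≤ b
        · have h1 : B.alloc (Function.update v i b) i = 1 := by
            refine (B.alloc01 _ i).resolve_left fun h0 => ?_
            exact hbc (le_antisymm (hlose' b hb h0) hcb)
          rw [Set.indicator_of_mem (Set.mem_Ici.2 hcb)]
          simp [g, h1]
        · rw [Set.indicator_of_notMem (by simpa using hcb)]
          exact zero_le

variable {t : ℕ} {succ : Fin n → Fin n → Prop}

theorem TLevel.measurable_level (A : TLevel n t) (i : Fin n) : Measurable (A.level i) := by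
  have hmono : Monotone (A.level i) := by
    intro b b' hbb'
    unfold TLevel.level
    have : (Finset.univ.filter fun τ : Fin t => A.thr i τ ≤ b).card
        ≤ (Finset.univ.filter fun τ : Fin t => A.thr i τ ≤ b').card :=
      Finset.card_le_card fun τ hτ => by
        rw [Finset.mem_filter] at hτ ⊢
        exact ⟨hτ.1, hτ.2.trans hbb'⟩
    omega
  exact hmono.measurable

theorem measurable_levels (A : TLevel n t) :
    Measurable fun (v : Fin n → ℝ) (i : Fin n) => A.level i (v i) :=
  measurable_pi_lambda _ fun i => (A.measurable_level i).comp (measurable_pi_apply i)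

theorem measurableSet_mem_winSet (A : TLevel n t) (i : Fin n) :
    MeasurableSet {v | i ∈ winSet M A succ v} :=
  measurable_levels A (MeasurableSet.of_discrete (s := {ℓ | i ∈ levelWinners M succ ℓ}))

theorem measurable_paymentM (A : TLevel n t) (i : Fin n) :
    Measurable fun v => paymentM M A succ v i := by
  have heq : (fun v => paymentM M A succ v i)
      = (fun ℓ : Fin n → ℤ =>
          sInf {b : ℝ | i ∈ levelWinners M succ (Function.update ℓ i (A.level i b))}) ∘
        fun v j => A.level j (v j) := by
    ext v
    unfold paymentM
    simp only [Function.comp_apply]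
    congr 1
    ext b
    rw [Set.mem_ofPred_eq, Set.mem_ofPred_eq, winSet_eq_levelWinners]
    have : (fun j => A.level j (Function.update v i b j))
        = Function.update (fun j => A.level j (v j)) i (A.level i b) := by
      ext j
      by_cases h : j = i
      · subst h; simp
      · simp [h]
    rw [this]
  rw [heq]
  exact (measurable_of_countable _).comp (measurable_levels A)

theorem paymentM_nonneg (A : TLevel n t) (hs : IsStrictTotalOrder (Fin n) succ)
    (hthr : ∀ i k, 0 ≤ A.thr i k) (v : Fin n → ℝ) (i : Fin n) : 0 ≤ paymentM M A succ v i := by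
  unfold paymentM
  refine Real.sInf_nonneg fun b hb => ?_
  rcases exists_winning_threshold (M := M) A hs v i with h | ⟨k, h⟩
  · exact absurd hb (h b)
  · exact (hthr i k).trans ((h b).1 hb)

/-- If every threshold of bidder `i`, as a posted price, earns at least the `w`-weight of the bids
it sells to, then the expected payment of `i` is at least the expected `w`-weight of `i`'s
winning bids. -/
theorem lintegral_winning_weight_le [∀ i, IsProbabilityMeasure (Fi i)] (A : TLevel n t)
    (hs : IsStrictTotalOrder (Fin n) succ) (i : Fin n) {w : ℝ → ℝ≥0∞} (hw : Measurable w)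
    (h : ∀ k, ∫⁻ b, (Set.Ici (A.thr i k)).indicator w b ∂Fi i
      ≤ ENNReal.ofReal (A.thr i k) * Fi i (Set.Ici (A.thr i k))) :
    ∫⁻ v, (if i ∈ winSet M A succ v then w (v i) else 0) ∂Measure.pi Fi
      ≤ ∫⁻ v, ENNReal.ofReal (if i ∈ winSet M A succ v then paymentM M A succ v i else 0)
          ∂Measure.pi Fi := by
  have hwm := measurableSet_mem_winSet (M := M) (succ := succ) A i
  refine lintegral_le_of_lmarginal_le {i}
    (Measurable.ite hwm (hw.comp (measurable_pi_apply i)) measurable_const)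
    (Measurable.ite hwm (measurable_paymentM A i) measurable_const).ennreal_ofReal ?_
  rw [lmarginal_singleton, lmarginal_singleton]
  intro v
  dsimp only
  rcases exists_winning_threshold (M := M) A hs v i with hk | ⟨k, hk⟩
  · simp [hk]
  · have hpay : ∀ b, paymentM M A succ (Function.update v i b) i = A.thr i k := by
      intro b
      unfold paymentM
      simp only [Function.update_idem, hk]
      exact csInf_Ici
    refine le_trans (le_of_eq ?_) ((h k).trans (le_of_eq ?_))
    · refine lintegral_congr fun b => ?_
      simp only [hk, Function.update_self, Set.indicator_apply, Set.mem_Ici]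
    · rw [← lintegral_indicator_const measurableSet_Ici]
      refine lintegral_congr fun b => ?_
      simp only [hk, hpay, Set.indicator_apply, Set.mem_Ici]
      split_ifs <;> simp

/-- The winning set maximizes the total step weight of an independent set. -/
theorem sum_stepWeight_le (A : TLevel n t) (hs : IsStrictTotalOrder (Fin n) succ) (d : ℕ → ℝ)
    (Q : Fin n → ℕ → ℝ) (s : ℕ) (τ : ℕ → Fin t)
    (hQ : ∀ i, ∀ k < s, Q i k = A.thr i (τ k)) (v : Fin n → ℝ) {I : Finset (Fin n)}
    (hI : M.Indep I) :
    ∑ i ∈ I, stepWeight d (Q i) s (v i)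
      ≤ ∑ i ∈ winSet M A succ v, stepWeight d (Q i) s (v i) := by
  have hrw : ∀ J : Finset (Fin n), ∑ i ∈ J, stepWeight d (Q i) s (v i)
      = ∑ k ∈ Finset.range s, ENNReal.ofReal (d k) *
        ((J.filter fun i => (((τ k : Fin t) : ℕ) : ℤ) ≤ A.level i (v i)).card : ℝ≥0∞) := by
    intro J
    unfold stepWeight
    rw [Finset.sum_comm]
    refine Finset.sum_congr rfl fun k hk => ?_
    rw [← Finset.mul_sum, Finset.card_filter, Nat.cast_sum]
    congr 1
    refine Finset.sum_congr rfl fun i _ => ?_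
    simp only [A.le_level_iff, ← hQ i k (Finset.mem_range.1 hk), Set.indicator_apply, Set.mem_Ici]
    split_ifs <;> simp
  rw [hrw, hrw]
  refine Finset.sum_le_sum fun k _ => mul_le_mul' le_rfl (Nat.cast_le.2 ?_)
  rw [winSet_eq_levelWinners]
  exact card_filter_level_le hs _ (Int.natCast_nonneg _) hI

/-- Charging price `1` to a fixed independent set of bidders. -/
noncomputable def fixedSetAuction (I : Finset (Fin n)) (hI : M.Indep I) :
    MatroidDSICAuction n M (Set.Icc 1 H) where
  alloc _ i := if i ∈ I then 1 else 0
  pay _ i := if i ∈ I then 1 else 0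
  alloc_meas _ := measurable_const
  pay_meas _ := measurable_const
  alloc01 _ i := by by_cases h : i ∈ I <;> simp [h]
  feas _ := by simpa using hI
  pay_nonneg _ i := by by_cases h : i ∈ I <;> simp [h]
  pay_le v hv i := by
    have := (hv i).1
    by_cases h : i ∈ I <;> simp [h, this]
  dsic _ _ _ _ _ := le_rfl

end Revenue

/-- The number of levels suffices for the geometric grid `(1 + a) ^ k - 1` with `a = ε / 2` to
reach `H`. -/
theorem le_one_add_pow_sub_one {ε H : ℝ} (hε : ε ∈ Set.Ioo (0 : ℝ) 1) (hH : 1 ≤ H) {t : ℕ}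
    (ht : 4 * (1 / ε + Real.log H / Real.log (1 + ε)) ≤ t) : H ≤ (1 + ε / 2) ^ t - 1 := by
  obtain ⟨h0, h1⟩ := hε
  have hlogH : 0 ≤ Real.log H := Real.log_nonneg hH
  have hx : 0 < Real.log (1 + ε) := Real.log_pos (by linarith)
  have hy : ε / 4 ≤ Real.log (1 + ε / 2) := by
    have := Real.one_sub_inv_le_log_of_pos (show 0 < 1 + ε / 2 by linarith)
    refine le_trans ?_ this
    rw [show 1 - (1 + ε / 2)⁻¹ = (ε / 2) / (1 + ε / 2) by field_simp; ring,
      le_div_iff₀ (by linarith)]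
    nlinarith
  have hz : Real.log (1 + ε) ≤ 2 * Real.log (1 + ε / 2) := by
    rw [← Real.log_rpow (by linarith)]
    refine Real.log_le_log (by linarith) ?_
    norm_num
    nlinarith
  have hmain : Real.log (1 + H) ≤ t * Real.log (1 + ε / 2) := by
    have hl2 : Real.log (1 + H) ≤ 1 + Real.log H := by
      calc Real.log (1 + H) ≤ Real.log (2 * H) := Real.log_le_log (by linarith) (by linarith)
        _ = Real.log 2 + Real.log H := Real.log_mul (by norm_num) (by linarith)
        _ ≤ 1 + Real.log H := by linarith [Real.log_two_lt_d9]
    have hA : 1 ≤ 4 * (1 / ε) * Real.log (1 + ε / 2) := by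
      calc (1 : ℝ) = 4 * (1 / ε) * (ε / 4) := by field_simp
        _ ≤ _ := by gcongr
    have hB : Real.log H ≤ 4 * (Real.log H / Real.log (1 + ε)) * Real.log (1 + ε / 2) := by
      calc Real.log H ≤ 2 * Real.log H := by linarith
        _ = 4 * (Real.log H / Real.log (1 + ε)) * (Real.log (1 + ε) / 2) := by
            field_simp; ring
        _ ≤ _ := by
            gcongr
            linarith
    have hC := mul_le_mul_of_nonneg_right ht (show 0 ≤ Real.log (1 + ε / 2) by linarith)
    nlinarith
  rw [← Real.log_pow] at hmain
  have := (Real.log_le_log_iff (by linarith) (by positivity)).1 hmain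
  linarith

/-- The numerical conclusion: if the rank and the optimum are both at most
`(1 + a) R + a · rank`, then `R` is at least a `1 - 2a` fraction of the optimum. -/
theorem ofReal_one_sub_mul_le {a : ℝ} (ha0 : 0 < a) (ha1 : a < 1 / 2) {X R : ℝ≥0∞} {r : ℕ}
    (hr : (r : ℝ≥0∞) ≤ ENNReal.ofReal (1 + a) * R + ENNReal.ofReal a * r)
    (hX : X ≤ ENNReal.ofReal (1 + a) * R + ENNReal.ofReal a * r) :
    ENNReal.ofReal (1 - 2 * a) * X ≤ R := by
  by_cases hR : R = ⊤
  · rw [hR]; exact le_top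
  lift R to NNReal using hR
  have hfin : ENNReal.ofReal (1 + a) * (R : ℝ≥0∞) + ENNReal.ofReal a * (r : ℝ≥0∞) ≠ ⊤ :=
    ENNReal.add_ne_top.2 ⟨ENNReal.mul_ne_top ENNReal.ofReal_ne_top ENNReal.coe_ne_top,
      ENNReal.mul_ne_top ENNReal.ofReal_ne_top (ENNReal.natCast_ne_top r)⟩
  lift X to NNReal using ne_top_of_le_ne_top hfin hX
  have heq : (ENNReal.ofReal (1 + a) * (R : ℝ≥0∞) + ENNReal.ofReal a * (r : ℝ≥0∞)).toReal
      = (1 + a) * R + a * r := by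
    rw [ENNReal.toReal_add (ENNReal.mul_ne_top ENNReal.ofReal_ne_top ENNReal.coe_ne_top)
      (ENNReal.mul_ne_top ENNReal.ofReal_ne_top (ENNReal.natCast_ne_top r)),
      ENNReal.toReal_mul, ENNReal.toReal_mul, ENNReal.toReal_ofReal (by linarith),
      ENNReal.toReal_ofReal ha0.le]
    simp
  have hr' := ENNReal.toReal_mono hfin hr
  have hX' := ENNReal.toReal_mono hfin hX
  rw [heq] at hr' hX'
  simp only [ENNReal.toReal_natCast, ENNReal.coe_toReal] at hr' hX'
  have hX0 : (0 : ℝ) ≤ X := X.2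
  have h1 : (1 - a) * X ≤ (1 + a) * R := by nlinarith
  have h2 : (1 - 2 * a) * X ≤ R := by
    have : (1 - 2 * a) * X * (1 + a) ≤ R * (1 + a) := by nlinarith [mul_nonneg (sq_nonneg a) hX0]
    exact le_of_mul_le_mul_right this (by linarith)
  rw [← ENNReal.ofReal_coe_nnreal, ← ENNReal.ofReal_mul (by linarith),
    ← ENNReal.ofReal_coe_nnreal]
  exact ENNReal.ofReal_le_ofReal h2

/-- Adding one more geometric step scales the weight by `1 + a` and adds at most `a`. -/
theorem stepWeight_succ_le {a : ℝ} (ha : 0 < a) (Q : ℕ → ℝ) (s : ℕ) (b : ℝ) :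
    stepWeight (fun k => a * (1 + a) ^ k) Q (s + 1) b
      ≤ ENNReal.ofReal (1 + a) *
          stepWeight (fun k => a * (1 + a) ^ k) (fun k => Q (k + 1)) s b + ENNReal.ofReal a := by
  unfold stepWeight
  rw [Finset.sum_range_succ', Finset.mul_sum]
  refine add_le_add (le_of_eq (Finset.sum_congr rfl fun k _ => ?_)) ?_
  · rw [← mul_assoc, ← ENNReal.ofReal_mul (by linarith)]
    congr 2
    ring
  · beta_reduce
    rw [pow_zero, mul_one]
    refine mul_le_of_le_one_right' ?_
    exact Set.indicator_le_self' (fun _ _ => zero_le) b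

/-- Representation error of `t`-level matroid auctions: there is a universal constant
`c > 0` such that for every matroid environment and product distribution with atomless
marginals supported in `[1,H]`, and every `t ≥ c (1/ε + ln H / ln(1+ε))`, some
`t`-level matroid auction earns expected revenue at least `(1-ε)` times optimal. -/
theorem representation_error_tlevel_matroid :
    ∃ c : ℝ, 0 < c ∧
      ∀ n : ℕ, 1 ≤ n →
      ∀ M : SimpleMatroid (Fin n),
      ∀ H : ℝ, 1 ≤ H →
      ∀ ε : ℝ, ε ∈ Set.Ioo (0 : ℝ) 1 →
      ∀ Fi : Fin n → Measure ℝ,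
        (∀ i, IsProbabilityMeasure (Fi i)) →
        (∀ i, ∀ x : ℝ, Fi i {x} = 0) →
        (∀ i, Fi i (Set.Icc 1 H) = 1) →
      ∀ t : ℕ, c * (1 / ε + Real.log H / Real.log (1 + ε)) ≤ t →
      ∀ succ : Fin n → Fin n → Prop, IsStrictTotalOrder (Fin n) succ →
      ∃ A : TLevel n t,
        ENNReal.ofReal (1 - ε) * OPTM n M (Set.Icc 1 H) (Measure.pi Fi) ≤
          ∫⁻ v, ENNReal.ofReal (RevM M A succ v) ∂(Measure.pi Fi) := by
  refine ⟨4, by norm_num, ?_⟩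
  intro n _ M H hH ε hε Fi hprob hatom hsupp t ht succ hs
  have hHt := le_one_add_pow_sub_one hε hH ht
  obtain ⟨hε0, hε1⟩ := hε
  set a := ε / 2 with ha
  have ha0 : 0 < a := by linarith
  have ha1 : a < 1 / 2 := by linarith
  obtain ⟨s, rfl⟩ : ∃ s, t = s + 1 := by
    refine Nat.exists_eq_succ_of_ne_zero ?_
    rintro rfl
    norm_num at hHt
    linarith
  choose p hpmono hpmem hpopt using fun i =>
    exists_monotone_optimal_price (Fi i) (hatom i) hH (hsupp i)
  set L : ℕ → ℝ := fun k => (1 + a) ^ k - 1 with hL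
  set d : ℕ → ℝ := fun k => a * (1 + a) ^ k with hd
  have hdL : ∀ k, L (k + 1) - L k = d k := by
    intro k
    simp only [hL, hd]
    ring
  have hd0 : ∀ k, 0 ≤ d k := fun k => by simp only [hd]; positivity
  have hLmono : Monotone L := monotone_nat_of_le_succ fun k => by linarith [hdL k, hd0 k]
  have hL0 : L 0 = 0 := by simp [hL]
  have hzero : ∀ i q, H ≤ q → (Fi i).real (Set.Ici q) = 0 := fun i q hq =>
    measureReal_Ici_eq_zero (Fi i) (hatom i) (hsupp i) hq
  let A : TLevel n (s + 1) :=
    { thr := fun i k => p i (L k)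
      mono := fun i k k' h => hpmono i (hLmono h) }
  refine ⟨A, ?_⟩
  set upper : Fin n → ℝ → ℝ≥0∞ := fun i => stepWeight d (fun k => p i (L k)) (s + 1)
  set lower : Fin n → ℝ → ℝ≥0∞ := fun i => stepWeight d (fun k => p i (L (k + 1))) s
  set R := ∫⁻ v, ENNReal.ofReal (RevM M A succ v) ∂(Measure.pi Fi) with hR
  have hupper : ∀ i c, ENNReal.ofReal c * Fi i (Set.Ici c)
      ≤ ∫⁻ b, (Set.Ici c).indicator (upper i) b ∂Fi i := by
    intro i c
    rw [lintegral_indicator_stepWeight (Fi i) hd0, ← ofReal_measureReal,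
      ← ENNReal.ofReal_mul' measureReal_nonneg]
    refine ENNReal.ofReal_le_ofReal ?_
    have := mul_le_sum_upper (S := fun q => (Fi i).real (Set.Ici q))
      (fun q => measureReal_nonneg) (hpmono i) (hpopt i) hLmono (hzero i) hL0 hHt c
    simpa only [hdL] using this
  have hlower : ∀ i k, ∫⁻ b, (Set.Ici (A.thr i k)).indicator (lower i) b ∂Fi i
      ≤ ENNReal.ofReal (A.thr i k) * Fi i (Set.Ici (A.thr i k)) := by
    intro i k
    rw [lintegral_indicator_stepWeight (Fi i) hd0, ← ofReal_measureReal,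
      ← ENNReal.ofReal_mul' measureReal_nonneg]
    refine ENNReal.ofReal_le_ofReal ?_
    have := sum_lower_le_mul (S := fun q => (Fi i).real (Set.Ici q))
      (hpmono i) (hpopt i) hLmono (hzero i) hL0 (Nat.le_of_lt_succ k.2)
    simpa only [hdL] using this
  have hthr : ∀ i k, 0 ≤ A.thr i k := fun i k => zero_le_one.trans (hpmem i _).1
  have hlowm : ∀ i, Measurable fun v : Fin n → ℝ =>
      if i ∈ winSet M A succ v then lower i (v i) else 0 := fun i =>
    Measurable.ite (measurableSet_mem_winSet A i)
      ((measurable_stepWeight _ _ _).comp (measurable_pi_apply i)) measurable_const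
  have hrev : ∫⁻ v, ∑ i ∈ winSet M A succ v, lower i (v i) ∂(Measure.pi Fi) ≤ R := by
    calc ∫⁻ v, ∑ i ∈ winSet M A succ v, lower i (v i) ∂(Measure.pi Fi)
        = ∫⁻ v, ∑ i, (if i ∈ winSet M A succ v then lower i (v i) else 0) ∂(Measure.pi Fi) := by
          refine lintegral_congr fun v => ?_
          rw [Finset.sum_ite_mem, Finset.univ_inter]
      _ = ∑ i, ∫⁻ v, (if i ∈ winSet M A succ v then lower i (v i) else 0) ∂(Measure.pi Fi) :=
          lintegral_finsetSum _ fun i _ => hlowm i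
      _ ≤ ∑ i, ∫⁻ v, ENNReal.ofReal (if i ∈ winSet M A succ v then paymentM M A succ v i else 0)
            ∂(Measure.pi Fi) :=
          Finset.sum_le_sum fun i _ => lintegral_winning_weight_le A hs i
            (measurable_stepWeight _ _ _) (hlower i)
      _ = R := by
          rw [hR, ← lintegral_finsetSum]
          · refine lintegral_congr fun v => ?_
            unfold RevM
            rw [ENNReal.ofReal_sum_of_nonneg fun i _ => ?_]
            split_ifs
            · exact paymentM_nonneg A hs hthr v i
            · exact le_rfl
          · exact fun i _ => (Measurable.ite (measurableSet_mem_winSet A i)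
              (measurable_paymentM A i) measurable_const).ennreal_ofReal
  obtain ⟨I₀, hI₀, hmax⟩ := Finset.exists_max_image
    (Finset.univ.filter fun I : Finset (Fin n) => M.Indep I) Finset.card
    ⟨∅, Finset.mem_filter.2 ⟨Finset.mem_univ _, M.empty_indep⟩⟩
  replace hI₀ : M.Indep I₀ := (Finset.mem_filter.1 hI₀).2
  replace hmax : ∀ I, M.Indep I → I.card ≤ I₀.card := fun I hI =>
    hmax I (Finset.mem_filter.2 ⟨Finset.mem_univ _, hI⟩)
  have hpoint : ∀ (v : Fin n → ℝ) (I : Finset (Fin n)), M.Indep I →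
      ∑ i ∈ I, upper i (v i) ≤ ENNReal.ofReal (1 + a) * ∑ i ∈ winSet M A succ v, lower i (v i)
        + ENNReal.ofReal a * I₀.card := by
    intro v I hI
    calc ∑ i ∈ I, upper i (v i)
        ≤ ∑ i ∈ I, (ENNReal.ofReal (1 + a) * lower i (v i) + ENNReal.ofReal a) :=
          Finset.sum_le_sum fun i _ => stepWeight_succ_le ha0 _ s _
      _ = ENNReal.ofReal (1 + a) * ∑ i ∈ I, lower i (v i) + ENNReal.ofReal a * I.card := by
          rw [Finset.sum_add_distrib, ← Finset.mul_sum, Finset.sum_const, nsmul_eq_mul, mul_comm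
            (I.card : ℝ≥0∞)]
      _ ≤ _ := by
          refine add_le_add (mul_le_mul' le_rfl ?_)
            (mul_le_mul' le_rfl (Nat.cast_le.2 (hmax I hI)))
          refine sum_stepWeight_le A hs d _ s (fun k => Fin.ofNat (s + 1) (k + 1)) ?_ v hI
          intro i k hk
          simp [A, Nat.mod_eq_of_lt (Nat.succ_lt_succ hk)]
  have hopt : ∀ B : MatroidDSICAuction n M (Set.Icc 1 H),
      ∫⁻ v, ∑ i, ENNReal.ofReal (B.pay v i) ∂(Measure.pi Fi)
        ≤ ENNReal.ofReal (1 + a) * R + ENNReal.ofReal a * I₀.card := by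
    intro B
    have hupm : ∀ i, Measurable fun v : Fin n → ℝ =>
        if B.alloc v i = 1 then upper i (v i) else 0 := fun i =>
      Measurable.ite (B.alloc_meas i (measurableSet_singleton 1))
        ((measurable_stepWeight _ _ _).comp (measurable_pi_apply i)) measurable_const
    calc ∫⁻ v, ∑ i, ENNReal.ofReal (B.pay v i) ∂(Measure.pi Fi)
        = ∑ i, ∫⁻ v, ENNReal.ofReal (B.pay v i) ∂(Measure.pi Fi) :=
          lintegral_finsetSum _ fun i _ => (B.pay_meas i).ennreal_ofReal
      _ ≤ ∑ i, ∫⁻ v, (if B.alloc v i = 1 then upper i (v i) else 0) ∂(Measure.pi Fi) :=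
          Finset.sum_le_sum fun i _ => lintegral_pay_le hatom hsupp B i
            (measurable_stepWeight _ _ _) (hupper i)
      _ = ∫⁻ v, ∑ i, (if B.alloc v i = 1 then upper i (v i) else 0) ∂(Measure.pi Fi) :=
          (lintegral_finsetSum _ fun i _ => hupm i).symm
      _ ≤ ∫⁻ v, (ENNReal.ofReal (1 + a) * ∑ i ∈ winSet M A succ v, lower i (v i)
            + ENNReal.ofReal a * I₀.card) ∂(Measure.pi Fi) := by
          refine lintegral_mono fun v => ?_
          rw [← Finset.sum_filter]
          exact hpoint v _ (B.feas v)
      _ = ENNReal.ofReal (1 + a) * ∫⁻ v, ∑ i ∈ winSet M A succ v, lower i (v i) ∂(Measure.pi Fi)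
            + ENNReal.ofReal a * I₀.card := by
          rw [lintegral_add_right _ measurable_const, lintegral_const_mul' _ _
            ENNReal.ofReal_ne_top, lintegral_const, measure_univ, mul_one]
      _ ≤ _ := by gcongr
  have hrank : (I₀.card : ℝ≥0∞) ≤ ENNReal.ofReal (1 + a) * R + ENNReal.ofReal a * I₀.card := by
    refine le_trans (le_of_eq ?_) (hopt (fixedSetAuction I₀ hI₀))
    have : ∀ i, ENNReal.ofReal (if i ∈ I₀ then (1 : ℝ) else 0) = if i ∈ I₀ then 1 else 0 := by
      intro i
      split_ifs <;> simp
    simp [fixedSetAuction, this]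
  have hfinal := ofReal_one_sub_mul_le ha0 ha1 hrank
    (X := OPTM n M (Set.Icc 1 H) (Measure.pi Fi)) (iSup_le hopt)
  rwa [show 1 - 2 * a = 1 - ε by rw [ha]; ring] at hfinal
end

section
/- There is a universal constant c > 0 such that for all integers n ≥ 1 and t ≥ 1, every collection 𝒳 of subsets of {1,…,n} with ∅ ∈ 𝒳, every nondecreasing vector Φ ∈ ℝᵗ, and every fixed strict total order on 𝒳 (used for tie-breaking), the pseudo-dimension of the class of functions {Rev_A : A is a t-level auction for 𝒳 with estimate vector Φ and the given tie-breaking order}, viewed as real-valued functions on ℝⁿ, is at most c·n·t·ln(n·t + 2). -/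
open MeasureTheory
open scoped ENNReal

attribute [local instance] Classical.propDecidable

/-- The number of thresholds of bidder `i` met by bid `b`.  Since the thresholds are
nondecreasing, bidder `i`'s level is this count minus one (and `-1`, i.e. count `0`,
means no threshold is met). -/
noncomputable def levCount {n t : ℕ} (A : TLevel n t) (i : Fin n) (b : ℝ) : ℕ :=
  (Finset.univ.filter fun τ : Fin t => A.thr i τ ≤ b).card

/-- The estimate `Φ_τ` attached to a bidder whose met-threshold count is `c`
(i.e. whose level is `τ = c - 1`); junk value `0` out of range. -/
noncomputable def phiAt {t : ℕ} (Φ : Fin t → ℝ) (c : ℕ) : ℝ :=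
  if h : c - 1 < t then Φ ⟨c - 1, h⟩ else 0

/-- `e_X(v) = Σ_{i ∈ X} Φ_{t_i(v_i)}`: the estimated virtual value of the feasible
set `X` at profile `v`. -/
noncomputable def eSet {n t : ℕ} (A : TLevel n t) (Φ : Fin t → ℝ)
    (v : Fin n → ℝ) (X : Finset (Fin n)) : ℝ :=
  ∑ i ∈ X, phiAt Φ (levCount A i (v i))

/-- The set selected by the `t`-level auction for the feasibility system `𝒳` with
estimates `Φ` and tie-breaking order `ord` on `𝒳`: if some bidder has level `-1`,
select `∅`; otherwise select the member of `𝒳` maximizing `e_X(v)`, ties broken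
by `ord`. -/
noncomputable def selected {n t : ℕ} (A : TLevel n t) (Φ : Fin t → ℝ)
    (𝒳 : Finset (Finset (Fin n))) (ord : Finset (Fin n) → Finset (Fin n) → Prop)
    (v : Fin n → ℝ) : Finset (Fin n) :=
  if ∃ i, levCount A i (v i) = 0 then ∅
  else if h : ∃ X, X ∈ 𝒳 ∧ ∀ Y ∈ 𝒳, Y ≠ X →
      (eSet A Φ v Y < eSet A Φ v X ∨ (eSet A Φ v Y = eSet A Φ v X ∧ ord X Y)) then
    h.choose
  else ∅

/-- The payment of a selected bidder `i`: the infimum over bids at which `i` would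
still belong to the selected set (unselected bidders pay 0 in `RevX` below). -/
noncomputable def payX {n t : ℕ} (A : TLevel n t) (Φ : Fin t → ℝ)
    (𝒳 : Finset (Finset (Fin n))) (ord : Finset (Fin n) → Finset (Fin n) → Prop)
    (v : Fin n → ℝ) (i : Fin n) : ℝ :=
  sInf {b : ℝ | i ∈ selected A Φ 𝒳 ord (Function.update v i b)}

/-- The revenue of the `t`-level auction for `𝒳` on profile `v`: the sum of the
selected bidders' critical payments. -/
noncomputable def RevX {n t : ℕ} (A : TLevel n t) (Φ : Fin t → ℝ)
    (𝒳 : Finset (Finset (Fin n))) (ord : Finset (Fin n) → Finset (Fin n) → Prop)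
    (v : Fin n → ℝ) : ℝ :=
  ∑ i ∈ selected A Φ 𝒳 ord v, payX A Φ 𝒳 ord v i

/-- `ord` is a strict total order on the members of `𝒳`. -/
def StrictTotalOn {n : ℕ} (𝒳 : Finset (Finset (Fin n)))
    (ord : Finset (Fin n) → Finset (Fin n) → Prop) : Prop :=
  (∀ X ∈ 𝒳, ¬ ord X X) ∧
  (∀ X ∈ 𝒳, ∀ Y ∈ 𝒳, ∀ Z ∈ 𝒳, ord X Y → ord Y Z → ord X Z) ∧
  (∀ X ∈ 𝒳, ∀ Y ∈ 𝒳, X ≠ Y → ord X Y ∨ ord Y X)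

/-- Pseudo-shattering of points `x` by a class `C` of real-valued functions. -/
def PseudoShatters {Q : Type*} (C : Set (Q → ℝ)) {m : ℕ} (x : Fin m → Q) : Prop :=
  ∃ r : Fin m → ℝ, ∀ T : Finset (Fin m), ∃ f ∈ C,
    (∀ j, j ∈ T → r j ≤ f (x j)) ∧ (∀ j, j ∉ T → f (x j) < r j)

section Counting

theorem sum_choose_le_pow (m d : ℕ) :
    ∑ k ∈ Finset.Iic d, m.choose k ≤ (m + 1) ^ d := by
  rw [add_pow]
  have : Finset.Iic d = Finset.range (d + 1) := by ext; simp
  rw [this]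
  refine Finset.sum_le_sum fun k hk => ?_
  have hkd : k ≤ d := by simpa [Nat.lt_succ_iff] using hk
  calc m.choose k ≤ m ^ k := Nat.choose_le_pow _ _
    _ ≤ m ^ k * 1 ^ (d - k) * d.choose k := by
      rw [one_pow, mul_one]
      exact Nat.le_mul_of_pos_right _ (Nat.choose_pos hkd)

/-- A system of more linear forms than variables satisfies a nontrivial linear relation with a
negative coefficient. -/
theorem exists_relation_neg {ι κ : Type*} [Fintype ι] [Fintype κ]
    (h : Fintype.card ι < Fintype.card κ) (a : κ → ι → ℝ) :
    ∃ w : κ → ℝ, (∀ p, ∑ j, w j * a j p = 0) ∧ ∃ j, w j < 0 := by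
  have hdep : ¬ LinearIndependent ℝ a := fun hli => by
    have := hli.fintype_card_le_finrank
    rw [Module.finrank_fintype_fun_eq_card] at this
    omega
  obtain ⟨w, hw, j, hj⟩ := Fintype.not_linearIndependent_iff.1 hdep
  have hrel : ∀ p, ∑ j, w j * a j p = 0 := fun p => by
    simpa using congrFun hw p
  rcases lt_or_gt_of_ne hj with hneg | hpos
  · exact ⟨w, hrel, j, hneg⟩
  · refine ⟨fun j => -w j, fun p => ?_, j, by simpa using hpos⟩
    simp [hrel p]

/-- The sign patterns realised by `m` affine functions. -/
noncomputable def signPatterns {ι : Type*} [Fintype ι] {m : ℕ} (a : Fin m → ι → ℝ)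
    (r : Fin m → ℝ) : Finset (Finset (Fin m)) :=
  Finset.univ.filter fun T => ∃ x : ι → ℝ, ∀ j, j ∈ T ↔ r j ≤ ∑ p, a j p * x p

theorem card_le_of_shatters_signPatterns {ι : Type*} [Fintype ι] {m : ℕ} (a : Fin m → ι → ℝ)
    (r : Fin m → ℝ) {S : Finset (Fin m)} (hS : (signPatterns a r).Shatters S) :
    S.card ≤ Fintype.card ι + 1 := by
  by_contra! hlt
  have hcard : Fintype.card (Option ι) < Fintype.card S := by simpa using hlt
  obtain ⟨w, hw, j₀, hj₀⟩ := exists_relation_neg hcard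
    fun (j : S) (p : Option ι) => p.elim (r j) (a j)
  obtain ⟨T, hT, hST⟩ := hS (t := (Finset.univ.filter fun j : S => 0 ≤ w j).map
    (Function.Embedding.subtype _)) (by
      intro j hj
      obtain ⟨j', -, rfl⟩ := Finset.mem_map.1 hj
      exact j'.2)
  obtain ⟨x, hx⟩ := (Finset.mem_filter.1 hT).2
  have hmem : ∀ j : S, 0 ≤ w j ↔ r j ≤ ∑ p, a j p * x p := fun j => by
    rw [← hx]
    have := Finset.ext_iff.1 hST j
    simpa using this.symm
  have hzero : ∑ j : S, w j * (∑ p, a j p * x p - r j) = 0 := by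
    have hr : ∑ j : S, w j * r j = 0 := hw none
    have ha : ∑ j : S, w j * ∑ p, a j p * x p = 0 := by
      simp_rw [Finset.mul_sum]
      rw [Finset.sum_comm]
      refine Finset.sum_eq_zero fun p _ => ?_
      have hp : ∑ j : S, w j * a j p = 0 := hw (some p)
      simp_rw [← mul_assoc]
      rw [← Finset.sum_mul, hp, zero_mul]
    simp_rw [mul_sub]
    rw [Finset.sum_sub_distrib, hr, ha, sub_zero]
  have hpos : 0 < ∑ j : S, w j * (∑ p, a j p * x p - r j) := by
    refine Finset.sum_pos' (fun j _ => ?_) ⟨j₀, Finset.mem_univ _, ?_⟩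
    · rcases le_or_gt 0 (w j) with h | h
      · exact mul_nonneg h (sub_nonneg.2 ((hmem j).1 h))
      · refine mul_nonneg_of_nonpos_of_nonpos h.le (sub_nonpos.2 ?_)
        exact le_of_not_ge fun h' => absurd ((hmem j).2 h') h.not_ge
    · refine mul_pos_of_neg_of_neg hj₀ (sub_neg.2 ?_)
      exact lt_of_not_ge fun h' => absurd ((hmem j₀).2 h') hj₀.not_ge
  exact hpos.ne' hzero

theorem card_signPatterns_le {ι : Type*} [Fintype ι] {m : ℕ} (a : Fin m → ι → ℝ)
    (r : Fin m → ℝ) : (signPatterns a r).card ≤ (m + 1) ^ (Fintype.card ι + 1) := by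
  have hvc : (signPatterns a r).vcDim ≤ Fintype.card ι + 1 :=
    Finset.sup_le fun S hS =>
      card_le_of_shatters_signPatterns a r (Finset.mem_shatterer.1 hS)
  calc (signPatterns a r).card ≤ (signPatterns a r).shatterer.card :=
        Finset.card_le_card_shatterer _
    _ ≤ ∑ k ∈ Finset.Iic (signPatterns a r).vcDim, (Fintype.card (Fin m)).choose k :=
        Finset.card_shatterer_le_sum_vcDim
    _ ≤ (m + 1) ^ (signPatterns a r).vcDim := by
        rw [Fintype.card_fin]; exact sum_choose_le_pow _ _
    _ ≤ _ := Nat.pow_le_pow_right (Nat.succ_pos m) hvc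

theorem le_of_two_pow_le {m d : ℕ} (hd : 1 ≤ d) (h : 2 ^ m ≤ (m + 1) ^ (3 * d)) :
    (m : ℝ) ≤ 28 * d * Real.log (d + 2) := by
  have hd' : (1 : ℝ) ≤ d := by exact_mod_cast hd
  have hm : (0 : ℝ) ≤ m := m.cast_nonneg
  have h1 : (m : ℝ) * Real.log 2 ≤ 3 * d * Real.log (m + 1) := by
    have h' : (2 : ℝ) ^ m ≤ ((m : ℝ) + 1) ^ (3 * d) := by exact_mod_cast h
    have := Real.log_le_log (by positivity) h'
    rw [Real.log_pow, Real.log_pow] at this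
    exact_mod_cast this
  have h2 : Real.log (m + 1) ≤ (m + 1) / (12 * d) - 1 + Real.log (12 * d) := by
    have := Real.log_le_sub_one_of_pos (x := ((m : ℝ) + 1) / (12 * d)) (by positivity)
    rw [Real.log_div (by positivity) (by positivity)] at this
    linarith
  have h3 : Real.log (12 * d) ≤ 4 * Real.log (d + 2) := by
    rw [← Real.log_rpow (by positivity)]
    refine Real.log_le_log (by positivity) ?_
    norm_cast
    have : 3 ^ 3 ≤ (d + 2) ^ 3 := Nat.pow_le_pow_left (by omega) 3
    calc 12 * d ≤ (d + 2) ^ 3 * (d + 2) := Nat.mul_le_mul (by omega) (by omega)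
      _ = (d + 2) ^ 4 := by ring
  have h4 : 3 * (d : ℝ) * Real.log (m + 1) ≤
      (m + 1) / 4 - 3 * d + 12 * d * Real.log (d + 2) := by
    calc 3 * (d : ℝ) * Real.log (m + 1)
        ≤ 3 * d * ((m + 1) / (12 * d) - 1 + 4 * Real.log (d + 2)) := by
          gcongr; linarith
      _ = _ := by field_simp; ring
  have h5 := Real.log_two_gt_d9
  nlinarith [mul_le_mul_of_nonneg_left h5.le hm]

end Counting

section Auction

variable {n t : ℕ}

theorem levCount_le (A : TLevel n t) (i : Fin n) (b : ℝ) : levCount A i b ≤ t := by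
  simpa [levCount] using Finset.card_filter_le (Finset.univ : Finset (Fin t)) (A.thr i · ≤ b)

theorem succ_le_levCount_iff (A : TLevel n t) (i : Fin n) (b : ℝ) (τ : Fin t) :
    (τ : ℕ) + 1 ≤ levCount A i b ↔ A.thr i τ ≤ b := by
  unfold levCount
  constructor
  · intro h
    by_contra! hb
    have hsub : (Finset.univ.filter fun σ : Fin t => A.thr i σ ≤ b) ⊆ Finset.Iio τ := by
      intro σ hσ
      rw [Finset.mem_Iio]
      by_contra! hle
      exact absurd ((A.mono i hle).trans (Finset.mem_filter.1 hσ).2) hb.not_ge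
    have := Finset.card_le_card hsub
    rw [Fin.card_Iio] at this
    omega
  · intro h
    have hsub : Finset.Iic τ ⊆ Finset.univ.filter fun σ : Fin t => A.thr i σ ≤ b :=
      fun σ hσ => Finset.mem_filter.2
        ⟨Finset.mem_univ _, (A.mono i (Finset.mem_Iic.1 hσ)).trans h⟩
    have := Finset.card_le_card hsub
    rwa [Fin.card_Iic] at this

theorem phiAt_mono {Φ : Fin t → ℝ} (hΦ : Monotone Φ) {k l : ℕ} (hkl : k ≤ l)
    (hk : 1 ≤ k) (hl : l ≤ t) : phiAt Φ k ≤ phiAt Φ l := by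
  unfold phiAt
  rw [dif_pos (by omega), dif_pos (by omega)]
  exact hΦ (Fin.mk_le_mk.2 (by omega))

/-- The value of `X` when bidder `i` meets `c i` thresholds. -/
noncomputable def countValue (Φ : Fin t → ℝ) (c : Fin n → ℕ) (X : Finset (Fin n)) : ℝ :=
  ∑ i ∈ X, phiAt Φ (c i)

/-- `X` is the winner among `𝒳` for the value function `e`, with ties broken by `ord`. -/
def IsWinner (𝒳 : Finset (Finset (Fin n))) (ord : Finset (Fin n) → Finset (Fin n) → Prop)
    (e : Finset (Fin n) → ℝ) (X : Finset (Fin n)) : Prop :=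
  X ∈ 𝒳 ∧ ∀ Y ∈ 𝒳, Y ≠ X → (e Y < e X ∨ (e Y = e X ∧ ord X Y))

/-- The set selected when bidder `i` meets `c i` thresholds. -/
noncomputable def countSelected (Φ : Fin t → ℝ) (𝒳 : Finset (Finset (Fin n)))
    (ord : Finset (Fin n) → Finset (Fin n) → Prop) (c : Fin n → ℕ) : Finset (Fin n) :=
  if ∃ i, c i = 0 then ∅
  else if h : ∃ X, IsWinner 𝒳 ord (countValue Φ c) X then h.choose else ∅

theorem selected_eq_countSelected (A : TLevel n t) (Φ : Fin t → ℝ)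
    (𝒳 : Finset (Finset (Fin n))) (ord : Finset (Fin n) → Finset (Fin n) → Prop)
    (v : Fin n → ℝ) :
    selected A Φ 𝒳 ord v = countSelected Φ 𝒳 ord fun i => levCount A i (v i) := by
  unfold selected countSelected
  congr

theorem exists_isWinner {𝒳 : Finset (Finset (Fin n))} (h𝒳 : 𝒳.Nonempty)
    {ord : Finset (Fin n) → Finset (Fin n) → Prop} (hord : StrictTotalOn 𝒳 ord)
    (e : Finset (Fin n) → ℝ) : ∃ X, IsWinner 𝒳 ord e X := by
  obtain ⟨-, htrans, htot⟩ := hord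
  induction h𝒳 using Finset.Nonempty.cons_induction with
  | singleton X => exact ⟨X, by simp [IsWinner]⟩
  | cons Z 𝒴 hZ h𝒴 ih =>
    have hsub : ∀ {X}, X ∈ 𝒴 → X ∈ Finset.cons Z 𝒴 hZ := fun h => Finset.mem_cons_of_mem h
    have hZmem := Finset.mem_cons_self Z 𝒴 (h := hZ)
    obtain ⟨X, hX, hwin⟩ := ih
      (fun X hX Y hY W hW => htrans X (hsub hX) Y (hsub hY) W (hsub hW))
      (fun X hX Y hY => htot X (hsub hX) Y (hsub hY))
    have hXZ : X ≠ Z := fun h => hZ (h ▸ hX)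
    by_cases hcmp : e Z < e X ∨ (e Z = e X ∧ ord X Z)
    · refine ⟨X, hsub hX, fun Y hY hne => ?_⟩
      rcases Finset.mem_cons.1 hY with rfl | hY
      · exact hcmp
      · exact hwin Y hY hne
    · have hcmp' : e X < e Z ∨ (e X = e Z ∧ ord Z X) := by
        rcases lt_trichotomy (e X) (e Z) with h | h | h
        · exact Or.inl h
        · refine Or.inr ⟨h, (htot X (hsub hX) Z hZmem hXZ).resolve_left fun h' => ?_⟩
          exact hcmp (Or.inr ⟨h.symm, h'⟩)
        · exact absurd (Or.inl h) hcmp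
      refine ⟨Z, hZmem, fun Y hY hne => ?_⟩
      have hY' := (Finset.mem_cons.1 hY).resolve_left hne
      by_cases hYX : Y = X
      · exact hYX ▸ hcmp'
      · rcases hwin Y hY' hYX with h | ⟨h, ho⟩ <;> rcases hcmp' with h' | ⟨h', ho'⟩
        · exact Or.inl (h.trans h')
        · exact Or.inl (h' ▸ h)
        · exact Or.inl (h ▸ h')
        · exact Or.inr ⟨h.trans h', htrans Z hZmem X (hsub hX) Y hY ho' ho⟩

variable {Φ : Fin t → ℝ} {𝒳 : Finset (Finset (Fin n))}
  {ord : Finset (Fin n) → Finset (Fin n) → Prop}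

theorem pos_of_mem_countSelected {c : Fin n → ℕ} {i : Fin n}
    (h : i ∈ countSelected Φ 𝒳 ord c) (j : Fin n) : 1 ≤ c j := by
  by_contra! hj
  have : ∃ i, c i = 0 := ⟨j, by omega⟩
  simp [countSelected, this] at h

theorem isWinner_countSelected (h𝒳 : 𝒳.Nonempty) (hord : StrictTotalOn 𝒳 ord)
    {c : Fin n → ℕ} (hc : ∀ i, 1 ≤ c i) :
    IsWinner 𝒳 ord (countValue Φ c) (countSelected Φ 𝒳 ord c) := by
  have h0 : ¬ ∃ i, c i = 0 := fun ⟨i, hi⟩ => by have := hc i; omega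
  have hex := exists_isWinner h𝒳 hord (countValue Φ c)
  rw [countSelected, if_neg h0, dif_pos hex]
  exact hex.choose_spec

theorem mem_countSelected_update (hΦ : Monotone Φ) (h𝒳 : 𝒳.Nonempty)
    (hord : StrictTotalOn 𝒳 ord) {c : Fin n → ℕ} {i : Fin n} {k : ℕ}
    (h : i ∈ countSelected Φ 𝒳 ord c) (hk : c i ≤ k) (hkt : k ≤ t) :
    i ∈ countSelected Φ 𝒳 ord (Function.update c i k) := by
  have hc := pos_of_mem_countSelected h
  have hc' : ∀ j, 1 ≤ Function.update c i k j := fun j => by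
    by_cases hj : j = i
    · subst hj; simpa using (hc j).trans hk
    · simpa [hj] using hc j
  obtain ⟨hX, hwinX⟩ := isWinner_countSelected (Φ := Φ) h𝒳 hord hc
  obtain ⟨hY, hwinY⟩ := isWinner_countSelected (Φ := Φ) h𝒳 hord hc'
  by_contra hi
  set X := countSelected Φ 𝒳 ord c
  set Y := countSelected Φ 𝒳 ord (Function.update c i k)
  have hXY : X ≠ Y := fun hXY => hi (hXY ▸ h)
  have hvY : countValue Φ (Function.update c i k) Y = countValue Φ c Y :=
    Finset.sum_congr rfl fun j hj => by
      rw [Function.update_of_ne (ne_of_mem_of_not_mem hj hi)]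
  have hvX : countValue Φ c X ≤ countValue Φ (Function.update c i k) X :=
    Finset.sum_le_sum fun j _ => by
      by_cases hj : j = i
      · subst hj; simpa using phiAt_mono hΦ hk (hc j) hkt
      · simp [hj]
  rcases hwinX Y hY hXY.symm with h1 | ⟨h1, o1⟩ <;>
    rcases hwinY X hX hXY with h2 | ⟨h2, o2⟩
  · linarith
  · linarith
  · linarith
  · exact hord.1 X hX (hord.2.1 X hX Y hY X hX o1 o2)

/-- The least number of thresholds that bidder `i` has to meet in order to be selected, when the
other bidders meet `c` thresholds. -/
noncomputable def criticalCount (Φ : Fin t → ℝ) (𝒳 : Finset (Finset (Fin n)))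
    (ord : Finset (Fin n) → Finset (Fin n) → Prop) (c : Fin n → ℕ) (i : Fin n) : ℕ :=
  sInf {k | i ∈ countSelected Φ 𝒳 ord (Function.update c i k)}

theorem payX_eq_thr (hΦ : Monotone Φ) (h𝒳 : 𝒳.Nonempty) (hord : StrictTotalOn 𝒳 ord)
    (A : TLevel n t) (v : Fin n → ℝ) {i : Fin n} (hi : i ∈ selected A Φ 𝒳 ord v) :
    ∃ τ : Fin t,
      (τ : ℕ) + 1 = criticalCount Φ 𝒳 ord (fun i => levCount A i (v i)) i ∧
        payX A Φ 𝒳 ord v i = A.thr i τ := by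
  set c : Fin n → ℕ := fun i => levCount A i (v i) with hc
  set k := criticalCount Φ 𝒳 ord c i
  rw [selected_eq_countSelected] at hi
  have hmem : c i ∈ {k | i ∈ countSelected Φ 𝒳 ord (Function.update c i k)} := by
    rw [Set.mem_ofPred_eq, Function.update_eq_self]
    exact hi
  have hk : i ∈ countSelected Φ 𝒳 ord (Function.update c i k) := Nat.sInf_mem ⟨_, hmem⟩
  have hkc : k ≤ c i := Nat.sInf_le hmem
  have hk1 : 1 ≤ k := by simpa using pos_of_mem_countSelected hk i
  have hkt : k ≤ t := hkc.trans (levCount_le A i (v i))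
  refine ⟨⟨k - 1, by omega⟩, by simp; omega, ?_⟩
  have hset : {b : ℝ | i ∈ selected A Φ 𝒳 ord (Function.update v i b)} =
      Set.Ici (A.thr i ⟨k - 1, by omega⟩) := by
    ext b
    have hup : (fun j => levCount A j (Function.update v i b j)) =
        Function.update c i (levCount A i b) := by
      ext j
      by_cases hj : j = i
      · subst hj; simp
      · simp [hj, hc]
    rw [Set.mem_ofPred_eq, Set.mem_Ici, ← succ_le_levCount_iff, selected_eq_countSelected, hup]
    have hk' : k - 1 + 1 = k := by omega
    simp only [hk']
    refine ⟨fun h => Nat.sInf_le h, fun h => ?_⟩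
    have := mem_countSelected_update hΦ h𝒳 hord hk (k := levCount A i b) (by simpa using h)
      (levCount_le A i b)
    simpa using this
  rw [payX, hset, csInf_Ici]

/-- The coefficient of the threshold `p` in the revenue, when bidder `i` meets `c i` thresholds. -/
noncomputable def revCoeff (Φ : Fin t → ℝ) (𝒳 : Finset (Finset (Fin n)))
    (ord : Finset (Fin n) → Finset (Fin n) → Prop) (c : Fin n → ℕ) (p : Fin n × Fin t) : ℝ :=
  if p.1 ∈ countSelected Φ 𝒳 ord c ∧ (p.2 : ℕ) + 1 = criticalCount Φ 𝒳 ord c p.1 then 1 else 0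

theorem RevX_eq_sum (hΦ : Monotone Φ) (h𝒳 : 𝒳.Nonempty) (hord : StrictTotalOn 𝒳 ord)
    (A : TLevel n t) (v : Fin n → ℝ) :
    RevX A Φ 𝒳 ord v =
      ∑ p, revCoeff Φ 𝒳 ord (fun i => levCount A i (v i)) p * A.thr p.1 p.2 := by
  rw [Fintype.sum_prod_type, RevX, ← Finset.sum_subset (Finset.subset_univ
    (selected A Φ 𝒳 ord v))]
  · refine Finset.sum_congr rfl fun i hi => ?_
    obtain ⟨τ, hτ, hpay⟩ := payX_eq_thr hΦ h𝒳 hord A v hi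
    rw [hpay, Finset.sum_eq_single τ]
    · rw [selected_eq_countSelected] at hi
      simp [revCoeff, hi, hτ]
    · intro σ _ hσ
      have : (σ : ℕ) + 1 ≠ criticalCount Φ 𝒳 ord (fun i => levCount A i (v i)) i := by
        rw [← hτ]
        intro h
        exact hσ (Fin.ext (by omega))
      simp [revCoeff, this]
    · simp
  · intro i _ hi
    rw [selected_eq_countSelected] at hi
    exact Finset.sum_eq_zero fun τ _ => by simp [revCoeff, hi]

/-- For each threshold, the number of profiles whose bid meets it. -/
noncomputable def metCounts {m : ℕ} (v : Fin m → Fin n → ℝ) (A : TLevel n t)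
    (p : Fin n × Fin t) : Fin (m + 1) :=
  ⟨(Finset.univ.filter fun j => A.thr p.1 p.2 ≤ v j p.1).card, by
    simpa [Nat.lt_succ_iff] using
      Finset.card_filter_le (Finset.univ : Finset (Fin m)) (A.thr p.1 p.2 ≤ v · p.1)⟩

theorem levCount_eq_of_metCounts_eq {m : ℕ} {v : Fin m → Fin n → ℝ} {A B : TLevel n t}
    (h : metCounts v A = metCounts v B) (j : Fin m) (i : Fin n) :
    levCount A i (v j i) = levCount B i (v j i) := by
  have hiff : ∀ τ, A.thr i τ ≤ v j i ↔ B.thr i τ ≤ v j i := fun τ => by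
    have hcard := congrArg Fin.val (congrFun h (i, τ))
    simp only [metCounts] at hcard
    have heq : (Finset.univ.filter fun j => A.thr i τ ≤ v j i) =
        Finset.univ.filter fun j => B.thr i τ ≤ v j i := by
      rcases le_total (A.thr i τ) (B.thr i τ) with hle | hle
      · exact (Finset.eq_of_subset_of_card_le
          (Finset.monotone_filter_right _ fun _ _ h => hle.trans h) hcard.le).symm
      · exact Finset.eq_of_subset_of_card_le
          (Finset.monotone_filter_right _ fun _ _ h => hle.trans h) hcard.ge
    simpa using Finset.ext_iff.1 heq j
  simp only [levCount, hiff]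

theorem two_pow_le_of_pseudoShatters (hΦ : Monotone Φ) (h𝒳 : 𝒳.Nonempty)
    (hord : StrictTotalOn 𝒳 ord) {m : ℕ} {v : Fin m → Fin n → ℝ}
    (hv : PseudoShatters {g | ∃ A : TLevel n t, g = RevX A Φ 𝒳 ord} v) :
    2 ^ m ≤ (m + 1) ^ (n * t) * (m + 1) ^ (n * t + 1) := by
  obtain ⟨r, hr⟩ := hv
  have hA : ∀ T : Finset (Fin m), ∃ A : TLevel n t,
      ∀ j, j ∈ T ↔ r j ≤ RevX A Φ 𝒳 ord (v j) := fun T => by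
    obtain ⟨_, ⟨A, rfl⟩, h1, h2⟩ := hr T
    exact ⟨A, fun j => ⟨h1 j, fun h => by_contra fun hj => (h2 j hj).not_ge h⟩⟩
  choose A hA using hA
  have hfiber : ∀ q ∈ (Finset.univ : Finset (Fin n × Fin t → Fin (m + 1))),
      (Finset.univ.filter fun T => metCounts v (A T) = q).card ≤ (m + 1) ^ (n * t + 1) := by
    intro q _
    rcases (Finset.univ.filter fun T => metCounts v (A T) = q).eq_empty_or_nonempty with
      h | ⟨T₀, hT₀⟩
    · rw [h]; simp
    · have hq := (Finset.mem_filter.1 hT₀).2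
      have hcard := card_signPatterns_le
        (fun j => revCoeff Φ 𝒳 ord fun i => levCount (A T₀) i (v j i)) r
      rw [Fintype.card_prod, Fintype.card_fin, Fintype.card_fin] at hcard
      refine le_trans (Finset.card_le_card fun T hT => ?_) hcard
      have hT := (Finset.mem_filter.1 hT).2
      refine Finset.mem_filter.2 ⟨Finset.mem_univ _, fun p => (A T).thr p.1 p.2, fun j => ?_⟩
      rw [hA T j, RevX_eq_sum hΦ h𝒳 hord]
      simp only [levCount_eq_of_metCounts_eq (hT.trans hq.symm)]
  have := Finset.card_le_mul_card_image_of_maps_to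
    (s := (Finset.univ : Finset (Finset (Fin m)))) (f := fun T => metCounts v (A T))
    (fun T _ => Finset.mem_univ _) _ hfiber
  simpa [mul_comm] using this

end Auction

/-- There is a universal constant `c > 0` bounding the pseudo-dimension of the class of
revenue functions of `t`-level auctions for an arbitrary single-parameter feasibility
system `𝒳 ∋ ∅` (with any fixed nondecreasing estimate vector `Φ` and tie-breaking
order) by `c · n · t · ln(nt + 2)`. -/
theorem pseudoDim_tlevel_single_parameter :
    ∃ c : ℝ, 0 < c ∧
      ∀ n t : ℕ, 1 ≤ n → 1 ≤ t →
      ∀ 𝒳 : Finset (Finset (Fin n)), ∅ ∈ 𝒳 →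
      ∀ Φ : Fin t → ℝ, Monotone Φ →
      ∀ ord : Finset (Fin n) → Finset (Fin n) → Prop, StrictTotalOn 𝒳 ord →
      ∀ (m : ℕ) (v : Fin m → (Fin n → ℝ)),
        PseudoShatters {g | ∃ A : TLevel n t, g = RevX A Φ 𝒳 ord} v →
        (m : ℝ) ≤ c * n * t * Real.log (n * t + 2) := by
  refine ⟨28, by norm_num, fun n t hn ht 𝒳 h𝒳 Φ hΦ ord hord m v hv => ?_⟩
  have hd : 1 ≤ n * t := Nat.mul_pos hn ht
  have hpow : 2 ^ m ≤ (m + 1) ^ (3 * (n * t)) := by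
    refine (two_pow_le_of_pseudoShatters hΦ ⟨∅, h𝒳⟩ hord hv).trans ?_
    rw [← pow_add]
    exact Nat.pow_le_pow_right (Nat.succ_pos m) (by omega)
  simpa [mul_assoc] using le_of_two_pow_le hd hpow
end
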